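/- arXiv:1904.01358 — 2 statements merged into one kernel-verified Lean document; each statement's English description precedes it below -/
import Mathlib

section
/- For every permutation π, the Schubert polynomial is the generating function of reduced pipe dreams for π: 𝔖_π = ∑_{P ∈ PD(π)} x^{wt(P)}. -/
open MvPolynomial

/-- The simple transposition `s_a ∈ S_n` exchanging (1-indexed) positions `a`, `a+1`;
the identity when `a` is out of range. -/
def simpleT (n : ℕ) (a : ℕ) : Equiv.Perm (Fin n) :=
  if h : 0 < a ∧ a < n then
    Equiv.swap ⟨a - 1, lt_of_le_of_lt (Nat.sub_le a 1) h.2⟩ ⟨a, h.2⟩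
  else 1

/-- The permutation `s_{i_1} s_{i_2} ⋯ s_{i_k}` associated to a word. -/
def wordProd (n : ℕ) (α : List ℕ) : Equiv.Perm (Fin n) :=
  (α.map (simpleT n)).prod

/-- `α` is a reduced word for `π ∈ S_n`. -/
def IsRedWord (n : ℕ) (π : Equiv.Perm (Fin n)) (α : List ℕ) : Prop :=
  (∀ x ∈ α, 0 < x ∧ x < n) ∧ wordProd n α = π ∧
  ∀ γ : List ℕ, (∀ x ∈ γ, 0 < x ∧ x < n) → wordProd n γ = π → α.length ≤ γ.length

/-- `S` is the family of Schubert polynomials for `S_n` (1-indexed variables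
`x_1, …, x_n`): `S(w_0) = x_1^{n-1} ⋯ x_n^0`, and whenever `w(i) < w(i+1)`,
`(x_i - x_{i+1}) ⬝ S w = S (w s_i) - s_i ⬝ S (w s_i)`. -/
def SchubertFamily (n : ℕ) (S : Equiv.Perm (Fin n) → MvPolynomial ℕ ℤ) : Prop :=
  S Fin.revPerm = (∏ i : Fin n, X ((i : ℕ) + 1) ^ (n - 1 - (i : ℕ))) ∧
  ∀ (w : Equiv.Perm (Fin n)) (i : Fin n) (h : (i : ℕ) + 1 < n),
    w i < w ⟨(i : ℕ) + 1, h⟩ →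
    (X ((i : ℕ) + 1) - X ((i : ℕ) + 2)) * S w =
      S (w * Equiv.swap i ⟨(i : ℕ) + 1, h⟩) -
        rename (Equiv.swap ((i : ℕ) + 1) ((i : ℕ) + 2))
          (S (w * Equiv.swap i ⟨(i : ℕ) + 1, h⟩))

/-- The word of a pipe dream given by its (finite) set `D` of crossing tiles (0-indexed
positions `(row, column)`): read rows top to bottom, each row right to left, recording
the letter `i + j + 1` for a crossing at `(i, j)`. -/
def pdWord (D : Finset (ℕ × ℕ)) : List ℕ :=
  (List.range ((D.sup (fun p => max p.1 p.2)) + 1)).flatMap (fun i =>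
    ((List.range ((D.sup (fun p => max p.1 p.2)) + 1)).reverse).filterMap (fun j =>
      if (i, j) ∈ D then some (i + j + 1) else none))

/-- `D` is a reduced pipe dream with permutation `π`: no two pipes cross twice and the
pipe entering in row `i` exits in column `π(i)`; equivalently, the row reading word of
`D` is a reduced word for `π`. -/
def IsPipeDream (n : ℕ) (π : Equiv.Perm (Fin n)) (D : Finset (ℕ × ℕ)) : Prop :=
  IsRedWord n π (pdWord D)


namespace PD

section Abstract
variable {R E : Type*} [CommRing R] [Ring E] [Algebra R E]

/-- The relations of the nilCoxeter algebra. -/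
structure Nil (u : ℕ → E) : Prop where
  sq : ∀ a, u a * u a = 0
  comm : ∀ a b, a + 2 ≤ b → u a * u b = u b * u a
  braid : ∀ a, u a * u (a + 1) * u a = u (a + 1) * u a * u (a + 1)

/-- The factor `1 + x u_a`. -/
def hh (u : ℕ → E) (a : ℕ) (x : R) : E := 1 + x • u a

/-- The product of `1 + x u_a` over the `k` letters `i + k - 1, …, i`. -/
def BB (u : ℕ → E) : ℕ → ℕ → R → E
  | 0, _, _ => 1
  | (k+1), i, x => BB u k (i+1) x * hh u i x

variable {u : ℕ → E}

theorem hh_mul (hu : Nil u) (a : ℕ) (x y : R) : hh u a x * hh u a y = hh u a (x + y) := by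
  simp only [hh, mul_add, add_mul, smul_mul_smul_comm, hu.sq, mul_one, one_mul]
  module

theorem hh_zero (a : ℕ) : hh u a (0 : R) = 1 := by simp [hh]

theorem yb (hu : Nil u) (a : ℕ) (x y : R) :
    hh u (a+1) (x - y) * hh u a x * hh u (a+1) y = hh u a y * hh u (a+1) x * hh u a (x - y) := by
  have h1 := hu.sq a
  have h2 := hu.sq (a+1)
  have h3 := hu.braid a
  simp only [hh, mul_add, add_mul, smul_mul_assoc, mul_smul_comm, mul_one, one_mul, h1, h2, h3,
    smul_add]
  module

theorem comm_hh (hu : Nil u) {a b : ℕ} (h : a + 2 ≤ b) (x : R) : Commute (u a) (hh u b x) := by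
  unfold hh
  exact (Commute.one_right _).add_right (Commute.smul_right (hu.comm a b h) x)

theorem comm_BB (hu : Nil u) (a k : ℕ) : ∀ (b : ℕ), a + 2 ≤ b → ∀ x : R, Commute (u a) (BB u k b x) := by
  induction k with
  | zero => intro b _ x; exact Commute.one_right _
  | succ k ih =>
    intro b h x
    exact (ih (b+1) (by omega) x).mul_right (comm_hh hu h x)

theorem hh_comm_BB (hu : Nil u) (a k b : ℕ) (h : a + 2 ≤ b) (x y : R) :
    Commute (hh u a x) (BB u k b y) := by
  unfold hh
  exact (Commute.one_left _).add_left (Commute.smul_left (comm_BB hu a k b h y) x)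

theorem BB_comm (hu : Nil u) (k : ℕ) : ∀ (i : ℕ) (x y : R), Commute (BB u k i x) (BB u k i y) := by
  induction k with
  | zero => intro i x y; exact Commute.one_right _
  | succ k ih =>
    intro i x y
    cases k with
    | zero =>
      simp only [BB, one_mul, Commute, SemiconjBy, hh_mul hu, add_comm]
    | succ k =>
      have key : ∀ x y : R, BB u (k+1) (i+1) x * BB u k (i+2) y
          = BB u (k+1) (i+1) y * BB u k (i+2) x * hh u (i+1) (x - y) := by
        intro x y
        have e1 : BB u k (i+2) y = BB u (k+1) (i+1) y * hh u (i+1) (-y) := by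
          simp only [BB, mul_assoc, hh_mul hu, add_neg_cancel, hh_zero, mul_one]
        rw [e1, ← mul_assoc, (ih (i+1) x y).eq, BB, BB, mul_assoc, mul_assoc (BB u k (i+1+1) x),
          hh_mul hu, sub_eq_add_neg]
        simp only [mul_assoc]
      have c : ∀ x y : R, hh u i x * BB u k (i+2) y = BB u k (i+2) y * hh u i x :=
        fun x y => (hh_comm_BB hu i k (i+2) le_rfl x y).eq
      have y1 := yb hu i x y
      change BB u (k+1) (i+1) x * hh u i x * (BB u k (i+2) y * hh u (i+1) y * hh u i y) =
        BB u (k+1) (i+1) y * hh u i y * (BB u k (i+2) x * hh u (i+1) x * hh u i x)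
      calc _ = BB u (k+1) (i+1) x * (hh u i x * BB u k (i+2) y) * hh u (i+1) y * hh u i y := by
            simp only [mul_assoc]
        _ = (BB u (k+1) (i+1) x * BB u k (i+2) y) * hh u i x * hh u (i+1) y * hh u i y := by
            rw [c]; simp only [mul_assoc]
        _ = BB u (k+1) (i+1) y * BB u k (i+2) x * (hh u (i+1) (x - y) * hh u i x * hh u (i+1) y)
              * hh u i y := by
            rw [key]; simp only [mul_assoc]
        _ = BB u (k+1) (i+1) y * (BB u k (i+2) x * hh u i y) * hh u (i+1) x *
              (hh u i (x - y) * hh u i y) := by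
            rw [y1]; simp only [mul_assoc]
        _ = _ := by
            rw [hh_mul hu, ← c, sub_add_cancel]; simp only [mul_assoc]

theorem BB_top (N : ℕ) : ∀ (i : ℕ) (x : R), u (i + N) = 0 → BB u (N+1) i x = BB u N i x := by
  induction N with
  | zero => intro i x h; simp [BB, hh, show u i = 0 from h]
  | succ N ih =>
    intro i x h
    rw [BB, ih (i+1) x (by rw [← h]; congr 1; omega), BB]

/-- The product of the first `k` rows. -/
def GG (u : ℕ → E) (N : ℕ) (k : ℕ) (x : ℕ → R) : E :=
  ((List.range k).map (fun i => BB u N (i+1) (x i))).prod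

theorem GG_succ (N k : ℕ) (x : ℕ → R) : GG u N (k+1) x = GG u N k x * BB u N (k+1) (x k) := by
  simp [GG, List.range_succ]

theorem GG_congr (N k : ℕ) (x y : ℕ → R) (h : ∀ i < k, x i = y i) : GG u N k x = GG u N k y := by
  unfold GG
  congr 1
  apply List.map_congr_left
  intro i hi
  rw [h i (List.mem_range.1 hi)]

theorem GG_rec (hu : Nil u) (N : ℕ) (hN : ∀ a, N ≤ a → u a = 0) (i : ℕ) (x : ℕ → R) (k : ℕ) (hk : i + 2 ≤ k) :
    (x i - x (i+1)) • (GG u N k x * u (i+1)) =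
      GG u N k x - GG u N k (x ∘ Equiv.swap i (i+1)) := by
  induction k, hk using Nat.le_induction with
  | base =>
    have e : GG u N i (x ∘ Equiv.swap i (i+1)) = GG u N i x := by
      apply GG_congr
      intro j hj
      simp only [Function.comp]
      rw [Equiv.swap_apply_of_ne_of_ne (by omega) (by omega)]
    rw [GG_succ, GG_succ, GG_succ, GG_succ, e]
    simp only [Function.comp, Equiv.swap_apply_left, Equiv.swap_apply_right]
    generalize x i = s
    generalize x (i+1) = t
    have e2 : ∀ t : R, BB u N (i+2) t = BB u N (i+1) t * (1 - t • u (i+1)) := by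
      intro t
      have h1 : BB u (N+1) (i+1) t = BB u N (i+1) t := BB_top N _ _ (hN _ (by omega))
      have h2 : (1 - t • u (i+1) : E) = hh u (i+1) (-t) := by simp [hh, sub_eq_add_neg]
      rw [← h1, BB, h2, mul_assoc, hh_mul hu, add_neg_cancel, hh_zero, mul_one]
    rw [show i + 1 + 1 = i + 2 from rfl, e2 s, e2 t]
    have c := (BB_comm hu N (i+1) s t).eq
    have e3 : ∀ P : E, P * BB u N (i+1) t * (BB u N (i+1) s * (1 - s • u (i+1))) =
      P * BB u N (i+1) s * BB u N (i+1) t * (1 - s • u (i+1)) := by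
      intro P
      rw [← mul_assoc, mul_assoc P, ← c]
      simp only [mul_assoc]
    rw [e3]
    generalize GG u N i x * BB u N (i+1) s = P
    rw [← mul_assoc]
    generalize P * BB u N (i+1) t = Q
    simp only [mul_sub, mul_one, sub_mul, mul_assoc, smul_mul_assoc, hu.sq, smul_zero, mul_zero,
      sub_zero, mul_smul_comm, sub_smul]
    abel
  | succ k hk ih =>
    rw [GG_succ, GG_succ]
    have : (x ∘ Equiv.swap i (i+1)) k = x k := by
      simp only [Function.comp]
      rw [Equiv.swap_apply_of_ne_of_ne (by omega) (by omega)]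
    rw [this, mul_assoc, ← (comm_BB hu (i+1) N (k+1) (by omega) (x k)).eq, ← mul_assoc,
      ← smul_mul_assoc, ih, sub_mul]

/-- Positions in reading order. -/
def posn (N k : ℕ) : List (ℕ × ℕ) :=
  (List.range k).flatMap (fun i => (List.range N).reverse.map (fun j => (i, j)))

theorem BB_eq (N : ℕ) : ∀ (i : ℕ) (x : R),
    BB u N i x = ((List.range N).reverse.map (fun j => hh u (i + j) x)).prod := by
  induction N with
  | zero => intro i x; simp [BB]
  | succ N ih =>
    intro i x
    rw [BB, ih, List.range_succ_eq_map]
    simp [List.map_reverse, Function.comp_def, add_assoc, add_comm 1]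

theorem GG_eq (N k : ℕ) (x : ℕ → R) :
    GG u N k x = ((posn N k).map (fun p => 1 + x p.1 • u (p.1 + p.2 + 1))).prod := by
  unfold GG posn
  rw [List.map_flatMap, List.flatMap_def, List.prod_flatten, List.map_map]
  congr 1
  apply List.map_congr_left
  intro i _
  simp only [Function.comp, List.map_map]
  rw [BB_eq]
  congr 1
  apply List.map_congr_left
  intro j _
  simp [hh, add_right_comm]

theorem expand {ι : Type*} [DecidableEq ι] (x : ι → R) (v : ι → E) (L : List ι) (hL : L.Nodup) :
    (L.map (fun p => 1 + x p • v p)).prod =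
      ∑ D ∈ L.toFinset.powerset, (∏ p ∈ D, x p) • ((L.filter (· ∈ D)).map v).prod := by
  induction L with
  | nil => simp
  | cons a L ih =>
    have ha := (List.nodup_cons.1 hL).1
    rw [List.map_cons, List.prod_cons, ih (List.nodup_cons.1 hL).2, List.toFinset_cons,
      Finset.sum_powerset_insert (by simpa using ha), add_mul, one_mul, Finset.mul_sum]
    congr 1
    · apply Finset.sum_congr rfl
      intro D hD
      have : a ∉ D := fun h => ha (by simpa using Finset.mem_powerset.1 hD h)
      rw [List.filter_cons_of_neg (by simpa using this)]
    · apply Finset.sum_congr rfl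
      intro D hD
      have : a ∉ D := fun h => ha (by simpa using Finset.mem_powerset.1 hD h)
      rw [List.filter_cons_of_pos (by simp), Finset.prod_insert this, List.map_cons, List.prod_cons]
      have e : L.filter (· ∈ insert a D) = L.filter (· ∈ D) := by
        apply List.filter_congr
        intro b hb
        have : b ≠ a := fun h => ha (h ▸ hb)
        simp [this]
      rw [e, smul_mul_smul_comm]

end Abstract

section Words

theorem posn_nodup (N k : ℕ) : (posn N k).Nodup := by
  unfold posn
  rw [List.nodup_flatMap]
  constructor
  · intro i _
    exact (List.nodup_reverse.2 List.nodup_range).map (fun a b h => by simpa using h)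
  · apply List.Nodup.pairwise_of_forall_ne List.nodup_range
    intro a _ b _ hab
    simp only [Function.onFun, List.disjoint_left]
    intro p hp hq
    simp only [List.mem_map] at hp hq
    obtain ⟨_, _, rfl⟩ := hp
    obtain ⟨_, _, h⟩ := hq
    exact hab (by simpa using (Prod.ext_iff.1 h).1.symm)

theorem mem_posn (N k : ℕ) (p : ℕ × ℕ) : p ∈ posn N k ↔ p.1 < k ∧ p.2 < N := by
  unfold posn
  simp only [List.mem_flatMap, List.mem_range, List.mem_map, List.mem_reverse]
  constructor
  · rintro ⟨i, hi, j, hj, rfl⟩; exact ⟨hi, hj⟩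
  · rintro ⟨h1, h2⟩; exact ⟨p.1, h1, p.2, h2, rfl⟩

/-- Word of a pipe dream read inside the `k × N` rectangle. -/
def wd (N k : ℕ) (D : Finset (ℕ × ℕ)) : List ℕ :=
  ((posn N k).filter (· ∈ D)).map (fun p => p.1 + p.2 + 1)

theorem wd_rows (N k : ℕ) (D : Finset (ℕ × ℕ)) : wd N k D =
    (List.range k).flatMap (fun i => ((List.range N).reverse).filterMap (fun j =>
      if (i, j) ∈ D then some (i + j + 1) else none)) := by
  unfold wd posn
  rw [List.filter_flatMap, List.map_flatMap]
  congr 1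
  funext i
  generalize (List.range N).reverse = L
  induction L with
  | nil => rfl
  | cons a L ih =>
    by_cases h : (i, a) ∈ D <;> simp_all

theorem pdWord_eq (D : Finset (ℕ × ℕ)) : pdWord D =
    wd (D.sup (fun p => max p.1 p.2) + 1) (D.sup (fun p => max p.1 p.2) + 1) D := by
  rw [wd_rows]; rfl

theorem wd_mono_k (N k : ℕ) (D : Finset (ℕ × ℕ)) (h : ∀ p ∈ D, p.1 < k) (k' : ℕ) (hk : k ≤ k') :
    wd N k' D = wd N k D := by
  induction k', hk using Nat.le_induction with
  | base => rfl
  | succ m hm ih =>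
    rw [← ih, wd_rows, wd_rows, List.range_succ, List.flatMap_append]
    simp only [List.flatMap_cons, List.flatMap_nil, List.append_nil]
    refine (congrArg _ ?_).trans (List.append_nil _)
    rw [List.filterMap_eq_nil_iff]
    intro j _
    rw [if_neg]
    intro hj
    have := h _ hj
    simp at this; omega

theorem wd_mono_N (N k : ℕ) (D : Finset (ℕ × ℕ)) (h : ∀ p ∈ D, p.2 < N) (N' : ℕ) (hk : N ≤ N') :
    wd N' k D = wd N k D := by
  induction N', hk using Nat.le_induction with
  | base => rfl
  | succ m hm ih =>
    rw [← ih, wd_rows, wd_rows, List.range_succ]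
    congr 1
    funext i
    rw [List.reverse_append, List.filterMap_append]
    simp only [List.reverse_cons, List.reverse_nil, List.nil_append]
    refine (congrArg (· ++ _) ?_).trans (List.nil_append _)
    rw [List.filterMap_eq_nil_iff]
    intro j hj
    rw [if_neg]
    intro hj'
    have := h _ hj'
    simp at this hj; omega

theorem pdWord_eq_wd (N : ℕ) (D : Finset (ℕ × ℕ)) (h : ∀ p ∈ D, p.1 < N ∧ p.2 < N) :
    pdWord D = wd N N D := by
  set M := D.sup (fun p => max p.1 p.2) + 1 with hM
  have h1 : ∀ p ∈ D, p.1 < M ∧ p.2 < M := by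
    intro p hp
    have : max p.1 p.2 ≤ D.sup (fun p => max p.1 p.2) :=
      Finset.le_sup (f := fun p : ℕ × ℕ => max p.1 p.2) hp
    omega
  rw [pdWord_eq, ← hM]
  rcases le_total M N with hMN | hMN
  · rw [wd_mono_k N M D (fun p hp => (h1 p hp).1) N hMN, wd_mono_N M M D (fun p hp => (h1 p hp).2) N hMN]
  · rw [wd_mono_k M N D (fun p hp => (h p hp).1) M hMN, wd_mono_N N N D (fun p hp => (h p hp).2) M hMN]

theorem mem_pdWord (D : Finset (ℕ × ℕ)) (p : ℕ × ℕ) (hp : p ∈ D) : p.1 + p.2 + 1 ∈ pdWord D := by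
  rw [pdWord_eq, wd]
  refine List.mem_map.2 ⟨p, ?_, rfl⟩
  rw [List.mem_filter, mem_posn]
  have : max p.1 p.2 ≤ D.sup (fun p => max p.1 p.2) :=
      Finset.le_sup (f := fun p : ℕ × ℕ => max p.1 p.2) hp
  refine ⟨by omega, by simpa using hp⟩

theorem length_wd (N : ℕ) (D : Finset (ℕ × ℕ)) (h : ∀ p ∈ D, p.1 < N ∧ p.2 < N) :
    (wd N N D).length = D.card := by
  unfold wd
  rw [List.length_map, ← List.toFinset_card_of_nodup ((posn_nodup N N).filter _)]
  congr 1
  ext p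
  simp only [List.mem_toFinset, List.mem_filter, mem_posn, decide_eq_true_eq]
  exact ⟨fun h => h.2, fun hp => ⟨h p hp, hp⟩⟩

end Words

section Perms
variable {n : ℕ}

/-- Descent at letter `a`. -/
def DD (a : ℕ) (w : Equiv.Perm (Fin n)) : Prop :=
  ∃ h : 0 < a ∧ a < n, w ⟨a, h.2⟩ < w ⟨a - 1, lt_of_le_of_lt (Nat.sub_le a 1) h.2⟩

theorem DD_iff {a : ℕ} (h : 0 < a ∧ a < n) (w : Equiv.Perm (Fin n)) : DD a w ↔
    w ⟨a, h.2⟩ < w ⟨a - 1, lt_of_le_of_lt (Nat.sub_le a 1) h.2⟩ :=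
  ⟨fun ⟨_, h'⟩ => h', fun h' => ⟨h, h'⟩⟩

theorem simpleT_pos {a : ℕ} (h : 0 < a ∧ a < n) : simpleT n a =
    Equiv.swap ⟨a - 1, lt_of_le_of_lt (Nat.sub_le a 1) h.2⟩ ⟨a, h.2⟩ := dif_pos h

theorem simpleT_sq (a : ℕ) : simpleT n a * simpleT n a = 1 := by
  unfold simpleT
  split_ifs <;> simp

/-- values of the simple transposition -/
theorem simpleT_val {a : ℕ} (h : 0 < a ∧ a < n) (p : Fin n) :
    ((simpleT n a p : Fin n) : ℕ) = if (p : ℕ) = a - 1 then a else if (p : ℕ) = a then a - 1 else p := by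
  rw [simpleT_pos h, Equiv.swap_apply_def]
  simp only [Fin.ext_iff]
  split_ifs <;> rfl

theorem DD_mul {a : ℕ} (h : 0 < a ∧ a < n) (w : Equiv.Perm (Fin n)) :
    DD a (w * simpleT n a) ↔ ¬ DD a w := by
  have hne : w ⟨a, h.2⟩ ≠ w ⟨a - 1, lt_of_le_of_lt (Nat.sub_le a 1) h.2⟩ := by
    intro h'
    have := Fin.ext_iff.1 (w.injective h')
    simp at this; omega
  simp only [DD_iff h, Equiv.Perm.mul_apply, simpleT_pos h, Equiv.swap_apply_left,
    Equiv.swap_apply_right, not_lt]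
  exact ⟨fun h => h.le, fun h => lt_of_le_of_ne h hne.symm⟩

/-- Inversions of a permutation. -/
def invSet (w : Equiv.Perm (Fin n)) : Finset (Fin n × Fin n) :=
  Finset.univ.filter (fun p => p.1 < p.2 ∧ w p.2 < w p.1)

theorem mem_invSet (w : Equiv.Perm (Fin n)) (p : Fin n × Fin n) :
    p ∈ invSet w ↔ p.1 < p.2 ∧ w p.2 < w p.1 := by
  simp [invSet]

/-- Coxeter length. -/
def inv (w : Equiv.Perm (Fin n)) : ℕ := (invSet w).card

theorem inv_step {a : ℕ} {w : Equiv.Perm (Fin n)} (h : DD a w) :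
    inv w = inv (w * simpleT n a) + 1 := by
  obtain ⟨ha, hd⟩ := h
  set P : Fin n × Fin n := (⟨a - 1, lt_of_le_of_lt (Nat.sub_le a 1) ha.2⟩, ⟨a, ha.2⟩) with hP
  have hmem : P ∈ invSet w := by
    simp only [invSet, Finset.mem_filter, Finset.mem_univ, true_and, hP]
    refine ⟨?_, hd⟩
    rw [Fin.lt_def]; simp; omega
  have hss : ∀ p, simpleT n a (simpleT n a p) = p := by
    intro p
    rw [← Equiv.Perm.mul_apply, simpleT_sq]; rfl
  unfold inv
  rw [← Finset.card_erase_add_one hmem]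
  congr 1
  have hlt : ∀ p q : Fin n, (p, q) ≠ P → p < q → simpleT n a p < simpleT n a q := by
    intro p q hpq hl
    rw [Fin.lt_def] at hl ⊢
    rw [simpleT_val ha, simpleT_val ha]
    simp only [hP, ne_eq, Prod.mk.injEq, Fin.ext_iff] at hpq
    split_ifs <;> omega
  have hPlt : ¬ (simpleT n a P.1 < simpleT n a P.2) := by
    rw [Fin.lt_def, simpleT_val ha, simpleT_val ha]
    simp only [hP]
    split_ifs <;> omega
  refine Finset.card_nbij' (fun p => (simpleT n a p.1, simpleT n a p.2))
    (fun p => (simpleT n a p.1, simpleT n a p.2)) ?_ ?_ ?_ ?_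
  · rintro ⟨p, q⟩ hp
    rw [Finset.mem_coe, Finset.mem_erase, mem_invSet] at hp
    rw [Finset.mem_coe, mem_invSet]
    simp only [Equiv.Perm.mul_apply, hss]
    exact ⟨hlt p q hp.1 hp.2.1, hp.2.2⟩
  · rintro ⟨p, q⟩ hp
    rw [Finset.mem_coe, mem_invSet] at hp
    rw [Finset.mem_coe, Finset.mem_erase, mem_invSet]
    simp only [Equiv.Perm.mul_apply] at hp
    have hne : (p, q) ≠ P := by
      rintro h
      rw [Prod.ext_iff] at h
      simp only at h
      have h2 := hp.2
      rw [h.1, h.2] at h2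
      simp only [hP, simpleT_pos ha, Equiv.swap_apply_left, Equiv.swap_apply_right] at h2
      exact lt_asymm h2 hd
    refine ⟨?_, ⟨hlt p q hne hp.1, hp.2⟩⟩
    intro h
    rw [Prod.ext_iff] at h
    simp only at h
    apply hPlt
    rw [← h.1, ← h.2, hss, hss]
    exact hp.1
  · rintro ⟨p, q⟩ _; simp [hss]
  · rintro ⟨p, q⟩ _; simp [hss]

theorem inv_step' {a : ℕ} (ha : 0 < a ∧ a < n) {w : Equiv.Perm (Fin n)} (h : ¬ DD a w) :
    inv (w * simpleT n a) = inv w + 1 := by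
  have := inv_step ((DD_mul ha w).2 h)
  rwa [mul_assoc, simpleT_sq, mul_one] at this

theorem eq_one_of_no_descent (w : Equiv.Perm (Fin n)) (h : ∀ a, ¬ DD a w) : w = 1 := by
  have hm : StrictMono w := by
    cases n with
    | zero => intro a; exact a.elim0
    | succ m =>
      rw [Fin.strictMono_iff_lt_succ]
      intro i
      have h1 := h (i + 1)
      have hne : w i.castSucc ≠ w i.succ := fun h' => by
        have := Fin.ext_iff.1 (w.injective h')
        simp at this
      simp only [DD, not_exists, not_lt] at h1
      have h2 := h1 ⟨by omega, by omega⟩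
      exact lt_of_le_of_ne h2 hne
  have : (hm.orderIsoOfSurjective w w.surjective) = OrderIso.refl (Fin n) := Subsingleton.elim _ _
  ext p
  have := congrArg (fun e => ((e p : Fin n) : ℕ)) this
  simpa using this

theorem inv_one : inv (1 : Equiv.Perm (Fin n)) = 0 := by
  unfold inv invSet
  rw [Finset.card_eq_zero, Finset.filter_eq_empty_iff]
  rintro ⟨p, q⟩ _ ⟨h1, h2⟩
  exact lt_asymm h1 h2

theorem wordProd_concat (α : List ℕ) (a : ℕ) :
    wordProd n (α ++ [a]) = wordProd n α * simpleT n a := by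
  simp [wordProd]

theorem inv_le (α : List ℕ) (hα : ∀ x ∈ α, 0 < x ∧ x < n) : inv (wordProd n α) ≤ α.length := by
  induction α using List.reverseRecOn with
  | nil => simp [wordProd, inv_one]
  | append_singleton α a ih =>
    have ih := ih (fun x hx => hα x (by simp [hx]))
    have ha := hα a (by simp)
    rw [wordProd_concat, List.length_append]
    simp only [List.length_singleton]
    by_cases h : DD a (wordProd n α)
    · have := inv_step h; omega
    · have := inv_step' ha h; omega

theorem exists_word (w : Equiv.Perm (Fin n)) : ∃ α : List ℕ, (∀ x ∈ α, 0 < x ∧ x < n) ∧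
    wordProd n α = w ∧ α.length = inv w := by
  induction h : inv w generalizing w with
  | zero =>
    refine ⟨[], by simp, ?_, rfl⟩
    by_cases hd : ∃ a, DD a w
    · obtain ⟨a, ha⟩ := hd
      have := inv_step ha; omega
    · push Not at hd
      rw [eq_one_of_no_descent w hd]; rfl
  | succ k ih =>
    have hd : ∃ a, DD a w := by
      by_contra hd
      push Not at hd
      rw [eq_one_of_no_descent w hd, inv_one] at h
      omega
    obtain ⟨a, ha⟩ := hd
    obtain ⟨α, h1, h2, h3⟩ := ih (w * simpleT n a) (by have := inv_step ha; omega)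
    refine ⟨α ++ [a], ?_, ?_, by simp [h3]⟩
    · intro x hx
      rcases List.mem_append.1 hx with hx | hx
      · exact h1 x hx
      · rw [List.mem_singleton.1 hx]; exact ha.1
    · rw [wordProd_concat, h2, mul_assoc, simpleT_sq, mul_one]

theorem isRed_iff (w : Equiv.Perm (Fin n)) (α : List ℕ) : IsRedWord n w α ↔
    (∀ x ∈ α, 0 < x ∧ x < n) ∧ wordProd n α = w ∧ α.length = inv w := by
  unfold IsRedWord
  refine and_congr_right fun h1 => and_congr_right fun h2 => ?_
  constructor
  · intro h
    obtain ⟨β, b1, b2, b3⟩ := exists_word w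
    have h4 := inv_le α h1
    rw [h2] at h4
    have := h β b1 b2
    omega
  · intro h γ g1 g2
    have := inv_le γ g1
    rw [g2] at this
    omega

theorem isRed_nil (w : Equiv.Perm (Fin n)) : IsRedWord n w [] ↔ w = 1 := by
  rw [isRed_iff]
  constructor
  · rintro ⟨_, h, _⟩; rw [← h]; rfl
  · rintro rfl; exact ⟨by simp, rfl, inv_one.symm⟩

theorem isRed_concat (w : Equiv.Perm (Fin n)) (α : List ℕ) (a : ℕ) :
    IsRedWord n w (α ++ [a]) ↔ DD a w ∧ IsRedWord n (w * simpleT n a) α := by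
  rw [isRed_iff, isRed_iff, wordProd_concat]
  constructor
  · rintro ⟨h1, h2, h3⟩
    have ha := h1 a (by simp)
    have h1' : ∀ x ∈ α, 0 < x ∧ x < n := fun x hx => h1 x (by simp [hx])
    have h4 := inv_le α h1'
    have h5 : wordProd n α = w * simpleT n a := by
      rw [← h2, mul_assoc, simpleT_sq, mul_one]
    rw [h5] at h4
    simp only [List.length_append, List.length_singleton] at h3
    have hd : DD a w := by
      by_contra hd
      have := inv_step' ha hd
      omega
    have := inv_step hd
    exact ⟨hd, h1', h5, by omega⟩
  · rintro ⟨hd, h1, h2, h3⟩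
    refine ⟨?_, ?_, ?_⟩
    · intro x hx
      rcases List.mem_append.1 hx with hx | hx
      · exact h1 x hx
      · rw [List.mem_singleton.1 hx]; exact hd.1
    · rw [h2, mul_assoc, simpleT_sq, mul_one]
    · have := inv_step hd
      simp; omega

variable {R : Type*} [CommRing R]

open Classical in
/-- Right multiplication by `u_a`. -/
noncomputable def UU (n : ℕ) (R : Type*) [CommRing R] (a : ℕ) :
    Module.End R (Equiv.Perm (Fin n) → R) where
  toFun f w := if DD a w then f (w * simpleT n a) else 0
  map_add' f g := by ext w; simp only [Pi.add_apply]; split_ifs <;> simp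
  map_smul' c f := by ext w; simp only [Pi.smul_apply, RingHom.id_apply]; split_ifs <;> simp

open Classical in
theorem UU_apply (a : ℕ) (f : Equiv.Perm (Fin n) → R) (w : Equiv.Perm (Fin n)) :
    UU n R a f w = if DD a w then f (w * simpleT n a) else 0 := rfl

theorem UU_sq (a : ℕ) : UU n R a * UU n R a = 0 := by
  refine LinearMap.ext fun f => funext fun w => ?_
  simp only [Module.End.mul_apply, UU_apply, LinearMap.zero_apply, Pi.zero_apply]
  split_ifs with h1 h2 <;> try rfl
  exact absurd h1 ((DD_mul h1.1 w).1 h2)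

theorem DD_far {a b : ℕ} (h : a + 2 ≤ b ∨ b + 2 ≤ a) (w : Equiv.Perm (Fin n)) :
    DD b (w * simpleT n a) ↔ DD b w := by
  by_cases ha : 0 < a ∧ a < n
  · unfold DD
    refine exists_congr fun hb => ?_
    have e1 : simpleT n a ⟨b, hb.2⟩ = ⟨b, hb.2⟩ := by
      rw [Fin.ext_iff, simpleT_val ha]; simp only; split_ifs <;> omega
    have e2 : simpleT n a ⟨b - 1, lt_of_le_of_lt (Nat.sub_le b 1) hb.2⟩ =
        ⟨b - 1, lt_of_le_of_lt (Nat.sub_le b 1) hb.2⟩ := by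
      rw [Fin.ext_iff, simpleT_val ha]; simp only; split_ifs <;> omega
    simp only [Equiv.Perm.mul_apply, e1, e2]
  · simp [simpleT, ha]

theorem simpleT_comm {a b : ℕ} (h : a + 2 ≤ b) :
    simpleT n a * simpleT n b = simpleT n b * simpleT n a := by
  by_cases ha : 0 < a ∧ a < n
  · by_cases hb : 0 < b ∧ b < n
    · refine Equiv.ext fun p => Fin.ext ?_
      simp only [Equiv.Perm.mul_apply, simpleT_val ha, simpleT_val hb]
      split_ifs <;> omega
    · simp [simpleT, hb]
  · simp [simpleT, ha]

theorem simpleT_braid {a : ℕ} (ha : 0 < a ∧ a < n) (hb : 0 < a + 1 ∧ a + 1 < n) :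
    simpleT n a * simpleT n (a+1) * simpleT n a =
      simpleT n (a+1) * simpleT n a * simpleT n (a+1) := by
  rw [simpleT_pos ha, simpleT_pos hb]
  simp only [Nat.add_sub_cancel]
  have h0 : a - 1 < n := by omega
  have h1 : (⟨a - 1, h0⟩ : Fin n) ≠ ⟨a, ha.2⟩ := by simp; omega
  have h2 : (⟨a - 1, h0⟩ : Fin n) ≠ ⟨a + 1, hb.2⟩ := by rw [ne_eq, Fin.ext_iff]; simp only; omega
  have h3 : (⟨a, ha.2⟩ : Fin n) ≠ ⟨a + 1, hb.2⟩ := by simp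
  have e1 := Equiv.swap_mul_swap_mul_swap h1 h2
  have e2 := Equiv.swap_mul_swap_mul_swap h3.symm h2.symm
  rw [e1, Equiv.swap_comm (⟨a + 1, hb.2⟩ : Fin n) ⟨a - 1, h0⟩, ← e2]
  rw [Equiv.swap_comm (⟨a, ha.2⟩ : Fin n) ⟨a - 1, h0⟩, Equiv.swap_comm (⟨a + 1, hb.2⟩ : Fin n) ⟨a, ha.2⟩]

theorem UU_comm {a b : ℕ} (h : a + 2 ≤ b) : UU n R a * UU n R b = UU n R b * UU n R a := by
  refine LinearMap.ext fun f => funext fun w => ?_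
  have d1 := DD_far (Or.inl h) w
  have d2 := DD_far (Or.inr h) w
  simp only [Module.End.mul_apply, UU_apply, mul_assoc, simpleT_comm h]
  split_ifs <;> first | rfl | (exfalso; tauto)

theorem DD_braid {a : ℕ} (ha : 0 < a ∧ a < n) (hb : 0 < a + 1 ∧ a + 1 < n)
    (w : Equiv.Perm (Fin n)) :
    (DD a w ∧ DD (a+1) (w * simpleT n a) ∧ DD a (w * simpleT n a * simpleT n (a+1))) ↔
    (DD (a+1) w ∧ DD a (w * simpleT n (a+1)) ∧ DD (a+1) (w * simpleT n (a+1) * simpleT n a)) := by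
  have h0 : a - 1 < n := by omega
  have a1 : simpleT n a ⟨a - 1, h0⟩ = ⟨a, ha.2⟩ := by
    rw [Fin.ext_iff, simpleT_val ha]; simp
  have a2 : simpleT n a ⟨a, ha.2⟩ = ⟨a - 1, h0⟩ := by
    rw [Fin.ext_iff, simpleT_val ha]; simp only; split_ifs <;> omega
  have a3 : simpleT n a ⟨a + 1, hb.2⟩ = ⟨a + 1, hb.2⟩ := by
    rw [Fin.ext_iff, simpleT_val ha]; simp only; split_ifs <;> omega
  have b1 : simpleT n (a+1) ⟨a - 1, h0⟩ = ⟨a - 1, h0⟩ := by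
    rw [Fin.ext_iff, simpleT_val hb]; simp only; split_ifs <;> omega
  have b2 : simpleT n (a+1) ⟨a, ha.2⟩ = ⟨a + 1, hb.2⟩ := by
    rw [Fin.ext_iff, simpleT_val hb]; simp
  have b3 : simpleT n (a+1) ⟨a + 1, hb.2⟩ = ⟨a, ha.2⟩ := by
    rw [Fin.ext_iff, simpleT_val hb]; simp
  simp only [DD_iff ha, DD_iff hb, Equiv.Perm.mul_apply, Nat.add_sub_cancel, a1, a2, a3, b1, b2, b3]
  generalize w ⟨a - 1, h0⟩ = x
  tauto

theorem UU_zero {a : ℕ} (h : ¬ (0 < a ∧ a < n)) : UU n R a = 0 := by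
  refine LinearMap.ext fun f => funext fun w => ?_
  rw [UU_apply, if_neg]
  · rfl
  · exact fun h' => h h'.1

theorem UU_braid (a : ℕ) :
    UU n R a * UU n R (a+1) * UU n R a = UU n R (a+1) * UU n R a * UU n R (a+1) := by
  by_cases ha : 0 < a ∧ a < n
  · by_cases hb : 0 < a + 1 ∧ a + 1 < n
    · refine LinearMap.ext fun f => funext fun w => ?_
      have h1 := DD_braid ha hb w
      have h2 : w * simpleT n a * simpleT n (a+1) * simpleT n a =
          w * simpleT n (a+1) * simpleT n a * simpleT n (a+1) := by
        have := congrArg (w * ·) (simpleT_braid ha hb)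
        simpa only [mul_assoc] using this
      simp only [Module.End.mul_apply, UU_apply, h2]
      split_ifs <;> first | rfl | (exfalso; tauto)
    · simp [UU_zero hb]
  · simp [UU_zero ha]

open MulOpposite in
/-- Generators, in the opposite of the endomorphism ring. -/
noncomputable def uu (n : ℕ) (R : Type*) [CommRing R] (a : ℕ) :
    (Module.End R (Equiv.Perm (Fin n) → R))ᵐᵒᵖ := op (UU n R a)

theorem uu_nil : Nil (uu n R) where
  sq a := by
    rw [uu, ← MulOpposite.op_mul, UU_sq]; rfl
  comm a b h := by
    simp only [uu, ← MulOpposite.op_mul, UU_comm h]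
  braid a := by
    simp only [uu, ← MulOpposite.op_mul, ← mul_assoc, UU_braid a]

/-- The identity element. -/
noncomputable def del (n : ℕ) (R : Type*) [CommRing R] : Equiv.Perm (Fin n) → R := Pi.single 1 1

open Classical in
theorem word_apply (α : List ℕ) (w : Equiv.Perm (Fin n)) :
    MulOpposite.unop ((α.map (uu n R)).prod) (del n R) w = if IsRedWord n w α then 1 else 0 := by
  induction α using List.reverseRecOn generalizing w with
  | nil =>
    rw [isRed_nil]
    simp [del, Pi.single_apply]
  | append_singleton α a ih =>
    rw [isRed_concat, List.map_append, List.prod_append, MulOpposite.unop_mul,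
      Module.End.mul_apply]
    simp only [List.map_cons, List.map_nil, List.prod_cons, List.prod_nil, mul_one, uu,
      MulOpposite.unop_op, UU_apply]
    rw [ih]
    split_ifs <;> first | rfl | (exfalso; tauto)

/-- The evaluated generating function -/
noncomputable def FF (n : ℕ) {R : Type*} [CommRing R] (x : ℕ → R) (w : Equiv.Perm (Fin n)) : R :=
  MulOpposite.unop (GG (uu n R) n n x) (del n R) w

open Classical in
theorem FF_eq (x : ℕ → R) (w : Equiv.Perm (Fin n)) :
    FF n x w = ∑ D ∈ (posn n n).toFinset.powerset,
      if IsPipeDream n w D then ∏ p ∈ D, x p.1 else 0 := by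
  rw [FF, GG_eq, expand (fun p : ℕ × ℕ => x p.1) (fun p => uu n R (p.1 + p.2 + 1)) _ (posn_nodup n n)]
  rw [Finset.unop_sum, LinearMap.sum_apply, Finset.sum_apply]
  apply Finset.sum_congr rfl
  intro D hD
  have hD' : ∀ p ∈ D, p.1 < n ∧ p.2 < n := by
    intro p hp
    have := Finset.mem_powerset.1 hD hp
    rwa [List.mem_toFinset, mem_posn] at this
  have e : ((posn n n).filter (· ∈ D)).map (fun p => uu n R (p.1 + p.2 + 1)) =
      (wd n n D).map (uu n R) := by
    rw [wd, List.map_map]; rfl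
  rw [e, MulOpposite.unop_smul, LinearMap.smul_apply, Pi.smul_apply, word_apply, IsPipeDream,
    pdWord_eq_wd n D hD']
  split_ifs <;> simp

theorem FF_rec (x : ℕ → R) (w : Equiv.Perm (Fin n)) (i : ℕ) (h : i + 1 < n)
    (hd : ¬ DD (i+1) w) :
    (x i - x (i+1)) * FF n x w =
      FF n x (w * simpleT n (i+1)) - FF n (x ∘ Equiv.swap i (i+1)) (w * simpleT n (i+1)) := by
  have hN : ∀ a, n ≤ a → uu n R a = 0 := by
    intro a ha
    rw [uu, UU_zero (by omega)]; rfl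
  have key := GG_rec (uu_nil (n := n) (R := R)) n hN i x n (by omega)
  have key2 := congrArg (fun e : (Module.End R (Equiv.Perm (Fin n) → R))ᵐᵒᵖ => MulOpposite.unop e (del n R) (w * simpleT n (i+1))) key
  have hd' : DD (i+1) (w * simpleT n (i+1)) := (DD_mul ⟨by omega, h⟩ w).2 hd
  simp only [MulOpposite.unop_smul, MulOpposite.unop_mul, MulOpposite.unop_sub,
    LinearMap.smul_apply, LinearMap.sub_apply, Pi.smul_apply, Pi.sub_apply, Module.End.mul_apply,
    smul_eq_mul] at key2
  rw [uu, MulOpposite.unop_op, UU_apply, if_pos hd', mul_assoc, simpleT_sq, mul_one] at key2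
  exact key2

end Perms

section Final
variable {n : ℕ}

/-- The divided difference recursion. -/
def Rec (n : ℕ) (S : Equiv.Perm (Fin n) → MvPolynomial ℕ ℤ) : Prop :=
  ∀ (w : Equiv.Perm (Fin n)) (i : ℕ), i + 1 < n → ¬ DD (i+1) w →
    (X (i + 1) - X (i + 2)) * S w =
      S (w * simpleT n (i+1)) - rename (Equiv.swap (i + 1) (i + 2)) (S (w * simpleT n (i+1)))

theorem eq_rev (w : Equiv.Perm (Fin n)) (h : ∀ i, i + 1 < n → DD (i+1) w) : w = Fin.revPerm := by
  have : Fin.revPerm * w = 1 := by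
    apply eq_one_of_no_descent
    intro a ha
    have h1 := ha.1
    obtain ⟨i, rfl⟩ : ∃ i, a = i + 1 := ⟨a - 1, by omega⟩
    have h2 := h i h1.2
    rw [DD_iff h1] at ha h2
    simp only [Equiv.Perm.mul_apply, Fin.revPerm_apply, Fin.rev_lt_rev] at ha
    exact lt_asymm ha h2
  have h3 := eq_inv_of_mul_eq_one_right this
  rw [h3]
  ext p
  simp [Equiv.Perm.inv_def]

theorem inv_le_sq (w : Equiv.Perm (Fin n)) : inv w ≤ n * n := by
  have := Finset.card_le_univ (invSet w)
  simpa [inv] using this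

theorem uniq (S T : Equiv.Perm (Fin n) → MvPolynomial ℕ ℤ) (hS : Rec n S) (hT : Rec n T)
    (h0 : S Fin.revPerm = T Fin.revPerm) (w : Equiv.Perm (Fin n)) : S w = T w := by
  induction h : n * n - inv w using Nat.strong_induction_on generalizing w with
  | _ k ih =>
    by_cases hw : ∃ i, i + 1 < n ∧ ¬ DD (i+1) w
    · obtain ⟨i, hi, hd⟩ := hw
      have e1 := hS w i hi hd
      have e2 := hT w i hi hd
      have e3 := inv_step' ⟨by omega, hi⟩ hd
      have e4 := inv_le_sq (w * simpleT n (i+1))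
      have e5 := ih (n * n - inv (w * simpleT n (i+1))) (by omega) _ rfl
      rw [e5, ← e2] at e1
      refine mul_left_cancel₀ ?_ e1
      rw [sub_ne_zero]
      intro h
      have := MvPolynomial.X_injective h
      omega
    · push Not at hw
      rw [eq_rev w hw, h0]

theorem rec_of_schubert (S : Equiv.Perm (Fin n) → MvPolynomial ℕ ℤ) (hS : SchubertFamily n S) :
    Rec n S := by
  intro w i hi hd
  have hr : 0 < i + 1 ∧ i + 1 < n := ⟨by omega, hi⟩
  have h1 := hS.2 w ⟨i, by omega⟩ hi
  have e : simpleT n (i+1) = Equiv.swap ⟨i, by omega⟩ ⟨i + 1, hi⟩ := simpleT_pos hr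
  rw [e]
  apply h1
  rw [DD_iff hr, not_lt] at hd
  refine lt_of_le_of_ne hd ?_
  intro h'
  have := Fin.ext_iff.1 (w.injective h')
  simp at this

/-- The pipe dream generating function. -/
noncomputable def PP (n : ℕ) (w : Equiv.Perm (Fin n)) : MvPolynomial ℕ ℤ :=
  FF n (fun i => X (i + 1)) w

theorem rec_PP : Rec n (PP n) := by
  intro w i hi hd
  have h := FF_rec (R := MvPolynomial ℕ ℤ) (fun i => X (i + 1)) w i hi hd
  have e : ∀ v, rename (Equiv.swap (i + 1) (i + 2)) (PP n v) =
      FF n ((fun i => (X (i + 1) : MvPolynomial ℕ ℤ)) ∘ Equiv.swap i (i+1)) v := by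
    intro v
    have hs : ∀ j : ℕ, Equiv.swap (i + 1) (i + 2) (j + 1) = Equiv.swap i (i + 1) j + 1 := by
      intro j
      simp only [Equiv.swap_apply_def]
      split_ifs <;> omega
    rw [PP, FF_eq, FF_eq, map_sum]
    apply Finset.sum_congr rfl
    intro D _
    split_ifs
    · rw [map_prod]
      apply Finset.prod_congr rfl
      intro p _
      rw [rename_X, hs]; rfl
    · simp
  rw [e]
  exact h

/-- The staircase. -/
def stair (n : ℕ) : Finset (ℕ × ℕ) :=
  (Finset.range n ×ˢ Finset.range n).filter (fun p => p.1 + p.2 + 1 < n)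

theorem mem_stair (p : ℕ × ℕ) : p ∈ stair n ↔ p.1 + p.2 + 1 < n := by
  simp only [stair, Finset.mem_filter, Finset.mem_product, Finset.mem_range]
  omega

theorem sub_stair {w : Equiv.Perm (Fin n)} {D : Finset (ℕ × ℕ)} (h : IsPipeDream n w D) :
    D ⊆ stair n := by
  intro p hp
  rw [mem_stair]
  exact (h.1 _ (mem_pdWord D p hp)).2

theorem card_of_pd {w : Equiv.Perm (Fin n)} {D : Finset (ℕ × ℕ)} (h : IsPipeDream n w D) :
    D.card = inv w := by
  have hD : ∀ p ∈ D, p.1 < n ∧ p.2 < n := by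
    intro p hp
    have := (mem_stair p).1 (sub_stair h hp)
    omega
  rw [← length_wd n D hD, ← pdWord_eq_wd n D hD]
  exact ((isRed_iff _ _).1 h).2.2

theorem stair_card : (stair n).card ≤ inv (Fin.revPerm : Equiv.Perm (Fin n)) := by
  rw [← Finset.card_attach]
  refine Finset.card_le_card_of_injOn (fun p =>
    (⟨p.1.1, by have := (mem_stair p.1).1 p.2; omega⟩,
     ⟨p.1.1 + p.1.2 + 1, (mem_stair p.1).1 p.2⟩)) ?_ ?_
  · intro p _
    rw [Finset.mem_coe, mem_invSet]
    simp only [Fin.revPerm_apply, Fin.rev_lt_rev, and_self, Fin.mk_lt_mk]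
    omega
  · intro p _ q _ h
    simp only [Prod.mk.injEq, Fin.mk.injEq] at h
    apply Subtype.ext
    apply Prod.ext <;> omega

theorem pd_rev {D : Finset (ℕ × ℕ)} (h : IsPipeDream n Fin.revPerm D) : D = stair n :=
  Finset.eq_of_subset_of_card_le (sub_stair h) (by rw [card_of_pd h]; exact stair_card)

theorem PP_one : PP n 1 = 1 := by
  classical
  rw [PP, FF_eq, Finset.sum_eq_single ∅]
  · rw [if_pos, Finset.prod_empty]
    have : pdWord ∅ = [] := by simp [pdWord]
    rw [IsPipeDream, this, isRed_nil]
  · intro D _ hD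
    rw [if_neg]
    intro h
    have := card_of_pd h
    rw [inv_one] at this
    exact hD (Finset.card_eq_zero.1 this)
  · intro h
    simp at h

theorem pd_stair : IsPipeDream n Fin.revPerm (stair n) := by
  by_contra hc
  have h0 : PP n Fin.revPerm = 0 := by
    rw [PP, FF_eq]
    apply Finset.sum_eq_zero
    intro D _
    rw [if_neg]
    intro h
    exact hc (pd_rev h ▸ h)
  have h1 := uniq (PP n) (fun _ => 0) rec_PP (by intro w i _ _; simp) h0 1
  rw [PP_one] at h1
  exact one_ne_zero h1

theorem stair_sub_posn : stair n ⊆ (posn n n).toFinset := by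
  intro p hp
  rw [mem_stair] at hp
  rw [List.mem_toFinset, mem_posn]
  omega

theorem PP_rev : PP n Fin.revPerm = ∏ i : Fin n, X ((i : ℕ) + 1) ^ (n - 1 - (i : ℕ)) := by
  classical
  rw [PP, FF_eq, Finset.sum_eq_single (stair n)]
  · rw [if_pos pd_stair, Finset.prod_finset_product (stair n) (Finset.range n)
      (fun i => Finset.range (n - 1 - i))]
    · simp only [Finset.prod_const, Finset.card_range]
      rw [Finset.prod_range]
    · intro p
      rw [mem_stair]
      simp only [Finset.mem_range]
      omega
  · intro D _ hD
    rw [if_neg]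
    exact fun h => hD (pd_rev h)
  · intro h
    exact absurd (Finset.mem_powerset.2 stair_sub_posn) h

theorem PP_finsum (w : Equiv.Perm (Fin n)) : PP n w =
    ∑ᶠ (D : Finset (ℕ × ℕ)) (_ : IsPipeDream n w D), ∏ p ∈ D, X (p.1 + 1) := by
  classical
  simp only [finsum_eq_if]
  rw [finsum_eq_sum_of_support_subset (s := (posn n n).toFinset.powerset), PP, FF_eq]
  intro D hD
  rw [Function.mem_support] at hD
  have h : IsPipeDream n w D := by
    by_contra h
    exact hD (if_neg h)
  rw [Finset.mem_coe, Finset.mem_powerset]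
  exact (sub_stair h).trans stair_sub_posn

end Final

end PD

/-- For every permutation `π`, the Schubert polynomial is the generating function of
reduced pipe dreams for `π`: `𝔖_π = ∑_{P ∈ PD(π)} x^{wt(P)}`, where `x^{wt(P)}` has one
factor `x_{i}` for each crossing tile of `P` in row `i`. -/
theorem schubert_eq_pipe_dream_generating_function (n : ℕ)
    (S : Equiv.Perm (Fin n) → MvPolynomial ℕ ℤ) (hS : SchubertFamily n S)
    (π : Equiv.Perm (Fin n)) :
    S π = ∑ᶠ (D : Finset (ℕ × ℕ)) (_ : IsPipeDream n π D),
            ∏ p ∈ D, X (p.1 + 1) := by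
  rw [← PD.PP_finsum]
  exact PD.uniq S (PD.PP n) (PD.rec_of_schubert S hS) PD.rec_PP (hS.1.trans PD.PP_rev.symm) π
end

section
/- (Kohnert's rule for Schubert polynomials) For every permutation π, the Schubert polynomial is the generating function of the Kohnert diagrams of the Rothe diagram of π: 𝔖_π = ∑_{D ∈ KD(RD(π))} x^{wt(D)}. -/
open MvPolynomial

/-- A Kohnert move on a box diagram (a finite set of 0-indexed `(row, column)` boxes):
select the rightmost box `(r, c)` of some row and move it to the first empty position
`(r', c)` above it in its column. -/
def KMove (D D' : Finset (ℕ × ℕ)) : Prop :=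
  ∃ r c r' : ℕ, (r, c) ∈ D ∧ (∀ c', c < c' → (r, c') ∉ D) ∧
    r' < r ∧ (r', c) ∉ D ∧ (∀ r'', r' < r'' → r'' < r → (r'', c) ∈ D) ∧
    D' = insert (r', c) (D.erase (r, c))

/-- The Rothe diagram of `π ∈ S_n` (0-indexed): the boxes `(i, j)` with `j < π(i)` and
`i < π⁻¹(j)`. -/
def rothe (n : ℕ) (π : Equiv.Perm (Fin n)) : Finset (ℕ × ℕ) :=
  ((Finset.univ : Finset (Fin n × Fin n)).filter
      (fun p => (p.2 : ℕ) < (π p.1 : ℕ) ∧ (p.1 : ℕ) < (π.symm p.2 : ℕ))).image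
    (fun p => ((p.1 : ℕ), (p.2 : ℕ)))

namespace Koh
open Finset

/-- number of elements of `S` that are at least `t`. -/
def rk (S : Finset ℕ) (t : ℕ) : ℕ := (S.filter (fun i => t ≤ i)).card

def gle (S T : Finset ℕ) : Prop := ∀ t, rk S t ≤ rk T t

theorem gle_refl (S : Finset ℕ) : gle S S := fun _ => le_rfl
theorem gle_trans {S T U : Finset ℕ} (h : gle S T) (h' : gle T U) : gle S U :=
  fun t => (h t).trans (h' t)

theorem rk_zero (S : Finset ℕ) : rk S 0 = S.card := by simp [rk]

theorem rk_succ (S : Finset ℕ) (t : ℕ) : rk S t = rk S (t+1) + if t ∈ S then 1 else 0 := by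
  unfold rk
  split_ifs with h
  · rw [← card_insert_of_notMem (a := t) (by simp)]
    congr 1; ext i; simp only [mem_filter, mem_insert]
    constructor
    · rintro ⟨a, b⟩
      rcases eq_or_lt_of_le b with rfl | b
      · left; rfl
      · right; exact ⟨a, b⟩
    · rintro (rfl | ⟨a, b⟩)
      · exact ⟨h, le_rfl⟩
      · exact ⟨a, by omega⟩
  · rw [add_zero]
    congr 1; ext i; simp only [mem_filter]
    constructor
    · rintro ⟨a, b⟩
      refine ⟨a, ?_⟩
      rcases eq_or_lt_of_le b with rfl | b
      · exact absurd a h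
      · exact b
    · rintro ⟨a, b⟩; exact ⟨a, by omega⟩

theorem rk_mono {S T : Finset ℕ} (h : S ⊆ T) (t : ℕ) : rk S t ≤ rk T t :=
  card_le_card (filter_subset_filter _ h)

theorem rk_anti (S : Finset ℕ) {s t : ℕ} (h : s ≤ t) : rk S t ≤ rk S s := by
  apply card_le_card
  intro i; simp only [mem_filter]; rintro ⟨a, b⟩; exact ⟨a, h.trans b⟩

/-- splitting the count. -/
theorem rk_split (S : Finset ℕ) {s t : ℕ} (h : s ≤ t) :
    rk S s = rk S t + (S.filter (fun i => s ≤ i ∧ i < t)).card := by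
  unfold rk
  rw [← card_union_of_disjoint]
  · congr 1; ext i; simp only [mem_filter, mem_union]
    constructor
    · rintro ⟨a, b⟩
      by_cases c : t ≤ i
      · left; exact ⟨a, c⟩
      · right; exact ⟨a, b, by omega⟩
    · rintro (⟨a, b⟩ | ⟨a, b, c⟩)
      · exact ⟨a, by omega⟩
      · exact ⟨a, b⟩
  · rw [disjoint_left]; intro i; simp only [mem_filter]; rintro ⟨_, a⟩ ⟨_, _, b⟩; omega

theorem rk_split_full (S : Finset ℕ) {s t : ℕ} (h : s ≤ t)
    (hS : ∀ i, s ≤ i → i < t → i ∈ S) : rk S s = rk S t + (t - s) := by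
  rw [rk_split S h]; congr 1
  rw [← Nat.card_Ico]; congr 1; ext i; simp only [mem_filter, mem_Ico]
  constructor
  · rintro ⟨_, a⟩; exact a
  · rintro ⟨a, b⟩; exact ⟨hS i a b, a, b⟩

theorem rk_split_miss (S : Finset ℕ) {s t m : ℕ} (h : s ≤ t)
    (hm : m ∉ S) (h1 : s ≤ m) (h2 : m < t) : rk S s + 1 ≤ rk S t + (t - s) := by
  rw [rk_split S h]
  have : (S.filter (fun i => s ≤ i ∧ i < t)).card < (Ico s t).card := by
    apply card_lt_card
    rw [ssubset_iff_of_subset]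
    · exact ⟨m, by simp [h1, h2], by simp [hm]⟩
    · intro i; simp only [mem_filter, mem_Ico]; rintro ⟨_, a⟩; exact a
  rw [Nat.card_Ico] at this; omega

theorem rk_insert (S : Finset ℕ) (a t : ℕ) (h : a ∉ S) :
    rk (insert a S) t = rk S t + if t ≤ a then 1 else 0 := by
  unfold rk
  rw [filter_insert]
  split_ifs with h'
  · rw [card_insert_of_notMem]; simp [h]
  · rfl

theorem rk_erase (S : Finset ℕ) (a t : ℕ) (h : a ∈ S) :
    rk (S.erase a) t + (if t ≤ a then 1 else 0) = rk S t := by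
  conv_rhs => rw [← insert_erase h]
  rw [rk_insert _ _ _ (notMem_erase a S)]

theorem rk_diff {S T : Finset ℕ} (h : S ⊆ T) (t : ℕ) : rk T t ≤ rk S t + (T \ S).card := by
  unfold rk
  rw [← card_union_of_disjoint]
  · apply card_le_card; intro i; simp only [mem_filter, mem_union, mem_sdiff]
    tauto
  · rw [disjoint_left]; intro i; simp only [mem_filter, mem_sdiff]; tauto

theorem sub_range_of_gle {S T : Finset ℕ} {N : ℕ} (h : gle S T) (hT : T ⊆ range N) :
    S ⊆ range N := by
  have h1 := h N
  have h2 : rk T N = 0 := by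
    unfold rk; rw [card_eq_zero, filter_eq_empty_iff]
    intro i hi; have := mem_range.1 (hT hi); omega
  rw [h2] at h1
  unfold rk at h1
  rw [Nat.le_zero, card_eq_zero, filter_eq_empty_iff] at h1
  intro i hi; have := h1 hi; rw [mem_range]; omega

/-- flags of length `A` with values below `N` -/
structure Flag (N A : ℕ) (u : ℕ → Finset ℕ) : Prop where
  card : ∀ i ≤ A, (u i).card = i
  sub : ∀ i < A, u i ⊆ u (i+1)
  bd : ∀ i ≤ A, u i ⊆ range N

theorem Flag.mono {N A : ℕ} {u : ℕ → Finset ℕ} (h : Flag N A u) {i j : ℕ} (hij : i ≤ j)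
    (hj : j ≤ A) : u i ⊆ u j := by
  induction j, hij using Nat.le_induction with
  | base => exact subset_rfl
  | succ j hij ih => exact (ih (by omega)).trans (h.sub j (by omega))

def fle (A : ℕ) (u v : ℕ → Finset ℕ) : Prop := ∀ i ≤ A, gle (u i) (v i)

theorem fle_refl (A : ℕ) (u : ℕ → Finset ℕ) : fle A u u := fun _ _ => gle_refl _
theorem fle_trans {A : ℕ} {u v w : ℕ → Finset ℕ} (h : fle A u v) (h' : fle A v w) : fle A u w :=
  fun i hi => gle_trans (h i hi) (h' i hi)

/-- the bubble operation. -/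
noncomputable def bub (k : ℕ) (u : ℕ → Finset ℕ) (i : ℕ) : Finset ℕ :=
  if i ≤ k then u i else (u (i+1)).erase (sInf (↑(u (i+1) \ u k) : Set ℕ))

theorem bub_le {k : ℕ} {u : ℕ → Finset ℕ} {i : ℕ} (h : i ≤ k) : bub k u i = u i := by
  simp [bub, h]

theorem bub_gt {N A k i : ℕ} {u : ℕ → Finset ℕ} (hu : Flag N (A+1) u) (h : k < i) (hi : i ≤ A) :
    ∃ m, m ∈ u (i+1) ∧ m ∉ u k ∧ (∀ z ∈ u (i+1), z ∉ u k → m ≤ z) ∧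
      bub k u i = (u (i+1)).erase m := by
  have hne : (u (i+1) \ u k).Nonempty := by
    rw [← card_pos, card_sdiff_of_subset (hu.mono (by omega) (by omega)), hu.card _ (by omega),
      hu.card _ (by omega)]
    omega
  have := Nat.sInf_mem (s := (↑(u (i+1) \ u k) : Set ℕ)) (Finset.coe_nonempty.2 hne)
  rw [mem_coe, mem_sdiff] at this
  refine ⟨_, this.1, this.2, ?_, ?_⟩
  · intro z hz hz'
    apply Nat.sInf_le
    simp [hz, hz']
  · simp [bub, h.not_ge]

theorem bub_between {N A k i : ℕ} {u : ℕ → Finset ℕ} (hu : Flag N (A+1) u) (h : k ≤ i)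
    (hi : i ≤ A) : u k ⊆ bub k u i ∧ bub k u i ⊆ u (i+1) ∧ (bub k u i).card = i := by
  rcases eq_or_lt_of_le h with rfl | h
  · rw [bub_le le_rfl]
    exact ⟨subset_rfl, hu.sub _ (by omega), hu.card _ (by omega)⟩
  · obtain ⟨m, h1, h2, h3, h4⟩ := bub_gt hu h hi
    rw [h4]
    refine ⟨?_, erase_subset _ _, ?_⟩
    · intro z hz
      rw [mem_erase]
      exact ⟨fun e => h2 (e ▸ hz), hu.mono (by omega) (by omega) hz⟩
    · rw [card_erase_of_mem h1, hu.card _ (by omega)]; rfl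

theorem rk_bub {N A k i : ℕ} {u : ℕ → Finset ℕ} (hu : Flag N (A+1) u) (h : k ≤ i)
    (hi : i ≤ A) (t : ℕ) : rk (bub k u i) t = min (rk (u (i+1)) t) (rk (u k) t + (i - k)) := by
  rcases eq_or_lt_of_le h with rfl | h
  · rw [bub_le le_rfl]
    have := rk_mono (hu.sub k (by omega)) t
    omega
  · obtain ⟨h1, h2, h3⟩ := bub_between hu h.le hi
    have e1 := rk_mono h2 t
    have e2 := rk_diff h1 t
    rw [card_sdiff_of_subset h1, h3, hu.card _ (by omega)] at e2
    obtain ⟨m, m1, m2, m3, m4⟩ := bub_gt hu h hi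
    apply le_antisymm
    · omega
    · rw [m4]
      have e3 := rk_erase _ m t m1
      split_ifs at e3 with c
      · -- everything in the difference is ≥ t
        have : rk (u k) t + (u (i+1) \ u k).card = rk (u (i+1)) t := by
          unfold rk
          rw [← card_union_of_disjoint]
          · congr 1; ext z; simp only [mem_filter, mem_union, mem_sdiff]
            constructor
            · rintro (⟨a, b⟩ | ⟨a, b⟩)
              · exact ⟨hu.mono (by omega) (by omega) a, b⟩
              · exact ⟨a, c.trans (m3 z a b)⟩
            · rintro ⟨a, b⟩
              by_cases q : z ∈ u k
              · left; exact ⟨q, b⟩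
              · right; exact ⟨a, q⟩
          · rw [disjoint_left]; intro i; simp only [mem_filter, mem_sdiff]; tauto
        rw [card_sdiff_of_subset (hu.mono (by omega) (by omega)), hu.card _ (by omega),
          hu.card _ (by omega)] at this
        omega
      · omega

theorem bub_flag {N A k : ℕ} {u : ℕ → Finset ℕ} (hu : Flag N (A+1) u) (hk : k ≤ A) :
    Flag N A (bub k u) where
  card i hi := by
    by_cases h : i ≤ k
    · rw [bub_le h, hu.card _ (by omega)]
    · exact (bub_between hu (by omega) hi).2.2
  bd i hi := by
    by_cases h : i ≤ k
    · rw [bub_le h]; exact hu.bd _ (by omega)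
    · exact (bub_between hu (by omega) hi).2.1.trans (hu.bd _ (by omega))
  sub i hi := by
    by_cases h : i + 1 ≤ k
    · rw [bub_le h, bub_le (by omega)]; exact hu.sub _ (by omega)
    · have h1 := bub_between hu (show k ≤ i + 1 by omega) (by omega)
      by_cases h' : i ≤ k
      · rw [bub_le h']
        have : i = k := by omega
        rw [this] at h1 ⊢; exact h1.1
      · obtain ⟨m, m1, m2, m3, m4⟩ := bub_gt hu (show k < i + 1 by omega) (by omega)
        obtain ⟨p, p1, p2, p3, p4⟩ := bub_gt hu (show k < i by omega) (by omega)
        rw [m4, p4]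
        intro z; simp only [mem_erase]
        rintro ⟨a, b⟩
        refine ⟨?_, hu.sub _ (by omega) b⟩
        rintro rfl
        have := m3 p (hu.sub _ (by omega) p1) p2
        have := p3 z b m2
        omega

theorem bub_max {N A k i : ℕ} {u : ℕ → Finset ℕ} (hu : Flag N (A+1) u) (h : k ≤ i) (hi : i ≤ A)
    {S : Finset ℕ} (h1 : u k ⊆ S) (h2 : S ⊆ u (i+1)) (h3 : S.card = i) : gle S (bub k u i) := by
  intro t
  rw [rk_bub hu h hi]
  have := rk_mono h2 t
  have e := rk_diff h1 t
  rw [card_sdiff_of_subset h1, h3, hu.card _ (by omega)] at e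
  omega

theorem bub_mono {N A k : ℕ} {u v : ℕ → Finset ℕ} (hu : Flag N (A+1) u) (hv : Flag N (A+1) v)
    (hk : k ≤ A) (h : fle (A+1) u v) : fle A (bub k u) (bub k v) := by
  intro i hi
  by_cases c : i ≤ k
  · rw [bub_le c, bub_le c]; exact h i (by omega)
  · intro t
    rw [rk_bub hu (by omega) hi, rk_bub hv (by omega) hi]
    have := h (i+1) (by omega) t
    have := h k (by omega) t
    omega

/-- Well-behaved operations on sets. -/
structure SetOp (N : ℕ) (φ : Finset ℕ → Finset ℕ) : Prop where
  card : ∀ S, (φ S).card = S.card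
  sub : ∀ S T, S ⊆ T → φ S ⊆ φ T
  mono : ∀ S T, S.card = T.card → gle S T → gle (φ S) (φ T)
  bd : ∀ S, S ⊆ range N → φ S ⊆ range N

theorem SetOp.flag {N A : ℕ} {φ : Finset ℕ → Finset ℕ} (hφ : SetOp N φ) {u : ℕ → Finset ℕ}
    (hu : Flag N A u) : Flag N A (fun i => φ (u i)) where
  card i hi := by rw [hφ.card, hu.card i hi]
  sub i hi := hφ.sub _ _ (hu.sub i hi)
  bd i hi := hφ.bd _ (hu.bd i hi)

theorem SetOp.fle {N A : ℕ} {φ : Finset ℕ → Finset ℕ} (hφ : SetOp N φ) {u v : ℕ → Finset ℕ}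
    (hu : Flag N A u) (hv : Flag N A v) (h : fle A u v) :
    fle A (fun i => φ (u i)) (fun i => φ (v i)) := fun i hi =>
  hφ.mono _ _ (by rw [hu.card i hi, hv.card i hi]) (h i hi)

theorem SetOp.bub {N A k : ℕ} {φ : Finset ℕ → Finset ℕ} (hφ : SetOp N φ) {u : ℕ → Finset ℕ}
    (hu : Flag N (A+1) u) :
    Koh.fle A (fun i => φ (bub k u i)) (Koh.bub k (fun i => φ (u i))) := by
  intro i hi
  by_cases c : i ≤ k
  · simp only [bub_le c]; exact gle_refl _
  · obtain ⟨h1, h2, h3⟩ := bub_between hu (show k ≤ i by omega) hi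
    exact bub_max (hφ.flag hu) (by omega) hi (hφ.sub _ _ h1) (hφ.sub _ _ h2)
      (by rw [hφ.card, h3])

end Koh

namespace Koh
open Finset

def up (r : ℕ) (S : Finset ℕ) : Finset ℕ :=
  if r ∈ S ∧ r+1 ∉ S then insert (r+1) (S.erase r) else S

def down (r : ℕ) (S : Finset ℕ) : Finset ℕ :=
  if r+1 ∈ S ∧ r ∉ S then insert r (S.erase (r+1)) else S

theorem mem_up (r : ℕ) (S : Finset ℕ) (z : ℕ) : z ∈ up r S ↔
    (z ≠ r ∧ z ≠ r+1 ∧ z ∈ S) ∨ (z = r+1 ∧ (r ∈ S ∨ r+1 ∈ S)) ∨ (z = r ∧ r ∈ S ∧ r+1 ∈ S) := by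
  unfold up
  split_ifs with h
  · simp only [mem_insert, mem_erase]
    by_cases h1 : z = r
    · subst h1; simp [h.2]
    · by_cases h2 : z = r+1
      · subst h2; simp [h.1]
      · simp [h1, h2]
  · by_cases h1 : z = r
    · subst h1; simp; tauto
    · by_cases h2 : z = r+1
      · subst h2; simp; tauto
      · simp [h1, h2]

theorem mem_down (r : ℕ) (S : Finset ℕ) (z : ℕ) : z ∈ down r S ↔
    (z ≠ r ∧ z ≠ r+1 ∧ z ∈ S) ∨ (z = r ∧ (r ∈ S ∨ r+1 ∈ S)) ∨ (z = r+1 ∧ r ∈ S ∧ r+1 ∈ S) := by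
  unfold down
  split_ifs with h
  · simp only [mem_insert, mem_erase]
    by_cases h1 : z = r
    · subst h1; simp [h.1]
    · by_cases h2 : z = r+1
      · subst h2; simp [h.2]
      · simp [h1, h2]
  · by_cases h1 : z = r
    · subst h1; simp; tauto
    · by_cases h2 : z = r+1
      · subst h2; simp; tauto
      · simp [h1, h2]

theorem rk_up (r : ℕ) (S : Finset ℕ) (t : ℕ) :
    rk (up r S) t = if t = r+1 then min (rk S r) (rk S (r+2) + 1) else rk S t := by
  have a1 := rk_succ S r
  have a2 := rk_succ S (r+1)
  have e : r+1+1 = r+2 := rfl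
  rw [e] at a2
  unfold up
  split_ifs with h h' h'
  · subst h'
    have h3 := rk_erase S r (r+1) h.1
    rw [rk_insert _ _ _ (by simp [h.2])]
    simp only [h.1, h.2, if_true, if_false] at *
    simp at h3 ⊢
    omega
  · have h3 := rk_erase S r t h.1
    rw [rk_insert _ _ _ (by simp [h.2])]
    split_ifs at * <;> omega
  · subst h'
    by_cases c : r ∈ S
    · have c' : r+1 ∈ S := by tauto
      simp only [c, c', if_true] at *
      omega
    · simp only [c, if_false] at *
      split_ifs at a2 <;> omega
  · rfl

theorem rk_down (r : ℕ) (S : Finset ℕ) (t : ℕ) :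
    rk (down r S) t = if t = r+1 then max (rk S r - 1) (rk S (r+2)) else rk S t := by
  have a1 := rk_succ S r
  have a2 := rk_succ S (r+1)
  have e : r+1+1 = r+2 := rfl
  rw [e] at a2
  unfold down
  split_ifs with h h' h'
  · subst h'
    have h3 := rk_erase S (r+1) (r+1) h.1
    rw [rk_insert _ _ _ (by simp [h.2])]
    simp only [h.1, h.2, if_true, if_false] at *
    simp at h3 ⊢
    omega
  · have h3 := rk_erase S (r+1) t h.1
    rw [rk_insert _ _ _ (by simp [h.2])]
    split_ifs at * <;> omega
  · subst h'
    by_cases c : r+1 ∈ S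
    · have c' : r ∈ S := by tauto
      simp only [c, c', if_true] at *
      omega
    · simp only [c, if_false] at *
      split_ifs at a1 <;> omega
  · rfl

theorem card_of_rk {S T : Finset ℕ} (h : rk S 0 = rk T 0) : S.card = T.card := by
  rwa [rk_zero, rk_zero] at h

theorem up_op {N r : ℕ} (hr : r + 1 < N) : SetOp N (up r) where
  card S := card_of_rk (by rw [rk_up]; simp)
  sub S T h z := by
    rw [mem_up, mem_up]
    have h1 := @h r
    have h2 := @h (r+1)
    have h3 := @h z
    tauto
  mono S T _ h t := by
    rw [rk_up, rk_up]
    have h1 := h r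
    have h2 := h (r+2)
    have h3 := h t
    split_ifs <;> omega
  bd S h z := by
    rw [mem_up]
    rintro (⟨_, _, a⟩ | ⟨rfl, _⟩ | ⟨rfl, _⟩)
    · exact h a
    · simpa using hr
    · simp; omega

theorem down_op {N r : ℕ} : SetOp N (down r) where
  card S := card_of_rk (by rw [rk_down]; simp)
  sub S T h z := by
    rw [mem_down, mem_down]
    have h1 := @h r
    have h2 := @h (r+1)
    have h3 := @h z
    tauto
  mono S T _ h t := by
    rw [rk_down, rk_down]
    have h1 := h r
    have h2 := h (r+2)
    have h3 := h t
    split_ifs <;> omega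
  bd S h z := by
    rw [mem_down]
    rintro (⟨_, _, a⟩ | ⟨rfl, a | a⟩ | ⟨rfl, _, a⟩)
    · exact h a
    · exact h a
    · have := h a; simp at this ⊢; omega
    · exact h a

theorem gle_up (r : ℕ) (S : Finset ℕ) : gle S (up r S) := by
  intro t; rw [rk_up]
  have a1 := rk_succ S r
  have a2 := rk_succ S (r+1)
  have e : r+1+1 = r+2 := rfl
  rw [e] at a2
  split_ifs with h
  · subst h; split_ifs at * <;> omega
  · rfl

theorem down_gle (r : ℕ) (S : Finset ℕ) : gle (down r S) S := by
  intro t; rw [rk_down]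
  have a1 := rk_succ S r
  have a2 := rk_succ S (r+1)
  have e : r+1+1 = r+2 := rfl
  rw [e] at a2
  split_ifs with h
  · subst h; split_ifs at * <;> omega
  · rfl

theorem gle_up_down (r : ℕ) (S : Finset ℕ) : gle S (up r (down r S)) := by
  intro t; rw [rk_up]
  simp only [rk_down]
  have a1 := rk_succ S r
  have a2 := rk_succ S (r+1)
  have e : r+1+1 = r+2 := rfl
  rw [e] at a2
  split_ifs with h
  all_goals first | omega | (subst h; split_ifs at * <;> omega)

theorem down_up (r : ℕ) (S : Finset ℕ) : down r (up r S) = down r S := by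
  ext z; rw [mem_down, mem_down, mem_up, mem_up, mem_up]
  by_cases h1 : r ∈ S <;> by_cases h2 : r + 1 ∈ S <;> by_cases h3 : z = r <;>
    by_cases h4 : z = r+1 <;> simp_all

theorem up_eq {r : ℕ} {S : Finset ℕ} (h : r ∈ S → r + 1 ∈ S) : up r S = S := by
  unfold up; rw [if_neg]; tauto
theorem down_eq {r : ℕ} {S : Finset ℕ} (h : r + 1 ∈ S → r ∈ S) : down r S = S := by
  unfold down; rw [if_neg]; tauto

open Classical in
noncomputable def gg (s : ℕ) (S : Finset ℕ) : Finset ℕ :=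
  if h : s ∈ S ∧ (range s \ S).Nonempty then insert ((range s \ S).max' h.2) (S.erase s) else S

theorem gg_spec (s : ℕ) (S : Finset ℕ) :
    (gg s S = S ∧ (s ∉ S ∨ ∀ m < s, m ∈ S)) ∨
    ∃ m < s, m ∉ S ∧ s ∈ S ∧ (∀ i, m < i → i < s → i ∈ S) ∧ gg s S = insert m (S.erase s) := by
  by_cases h : s ∈ S ∧ (range s \ S).Nonempty
  · right
    have h1 := (range s \ S).max'_mem h.2
    rw [mem_sdiff, mem_range] at h1
    refine ⟨_, h1.1, h1.2, h.1, ?_, by rw [gg, dif_pos h]⟩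
    intro i hi hi'
    by_contra hc
    have := (range s \ S).le_max' i (by simp [hi', hc])
    omega
  · left
    refine ⟨by rw [gg, dif_neg h], ?_⟩
    by_cases hs : s ∈ S
    · right
      intro m hm
      by_contra hc
      exact h ⟨hs, m, by simp [hm, hc]⟩
    · left; exact hs

theorem gg_eq_of_notMem {s : ℕ} {S : Finset ℕ} (h : s ∉ S) : gg s S = S := by
  rcases gg_spec s S with h' | ⟨m, _, _, h', _⟩
  · exact h'.1
  · exact absurd h' h

theorem gg_eq {s m : ℕ} {S : Finset ℕ} (hm : m < s) (h1 : m ∉ S) (h2 : s ∈ S)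
    (h3 : ∀ i, m < i → i < s → i ∈ S) : gg s S = insert m (S.erase s) := by
  rcases gg_spec s S with ⟨_, h' | h'⟩ | ⟨m', q1, q2, q3, q4, q5⟩
  · exact absurd h2 h'
  · exact absurd (h' m hm) h1
  · rw [q5]
    rcases lt_trichotomy m m' with c | c | c
    · exact absurd (h3 _ c q1) q2
    · rw [c]
    · exact absurd (q4 _ c hm) h1

theorem rk_move {S : Finset ℕ} {m s : ℕ} (hm : m < s) (h1 : m ∉ S) (h2 : s ∈ S) (t : ℕ) :
    rk (insert m (S.erase s)) t + (if m < t ∧ t ≤ s then 1 else 0) = rk S t := by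
  have := rk_erase S s t h2
  rw [rk_insert _ _ _ (by simp [h1])]
  split_ifs at * <;> omega

theorem gg_gle (s : ℕ) (S : Finset ℕ) : gle (gg s S) S := by
  intro t
  rcases gg_spec s S with h' | ⟨m, q1, q2, q3, q4, q5⟩
  · rw [h'.1]
  · rw [q5]; have := rk_move q1 q2 q3 t; omega

theorem gg_mono (s : ℕ) {S T : Finset ℕ} (h : gle S T) : gle (gg s S) (gg s T) := by
  intro t
  rcases gg_spec s T with h' | ⟨m, q1, q2, q3, q4, q5⟩
  · rw [h'.1]; exact (gg_gle s S t).trans (h t)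
  · have e := rk_move q1 q2 q3 t
    rw [← q5] at e
    have h1 := gg_gle s S t
    have h2 := h t
    split_ifs at e with c
    · by_cases heq : rk S t = rk T t
      · -- everything in [t,s] lies in S
        have f1 := rk_split_full T (s := t) (t := s+1) (by omega) (by
          intro i a b
          by_cases hi : i = s
          · rw [hi]; exact q3
          · exact q4 i (by omega) (by omega))
        have f2 : ∀ i, t ≤ i → i < s + 1 → i ∈ S := by
          intro i a b
          by_contra hc
          have := rk_split_miss S (s := t) (t := s+1) (by omega) hc a b
          have := h (s+1)
          omega
        have f3 := rk_succ T m
        have f4 := rk_split_full T (s := m+1) (t := t) (by omega) (by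
          intro i a b; exact q4 i (by omega) (by omega))
        have f5 : ∃ i, m ≤ i ∧ i < t ∧ i ∉ S := by
          by_contra hc
          push Not at hc
          have := rk_split_full S (s := m) (t := t) (by omega) (fun i a b => hc i a b)
          have := h m
          simp only [q2, if_false] at f3
          omega
        obtain ⟨i, i1, i2, i3⟩ := f5
        rcases gg_spec s S with ⟨_, h' | h'⟩ | ⟨m', p1, p2, p3, p4, p5⟩
        · exact absurd (f2 s (by omega) (by omega)) h'
        · exact absurd (h' i (by omega)) i3
        · have := rk_move p1 p2 p3 t
          rw [← p5] at this
          have : m' < t := by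
            by_contra hc
            exact p2 (f2 m' (by omega) (by omega))
          split_ifs at * <;> omega
      · omega
    · omega

theorem gg_op (N s : ℕ) : SetOp N (gg s) where
  card S := by
    rcases gg_spec s S with h' | ⟨m, q1, q2, q3, q4, q5⟩
    · rw [h'.1]
    · rw [q5, card_insert_of_notMem (by simp [q2]), card_erase_of_mem q3]
      have := card_pos.2 ⟨s, q3⟩; omega
  mono S T _ h := gg_mono s h
  bd S h := sub_range_of_gle (gg_gle s S) h
  sub S T h := by
    rcases gg_spec s T with ⟨h', c⟩ | ⟨m, q1, q2, q3, q4, q5⟩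
    · rw [h']
      rcases gg_spec s S with d | ⟨m', p1, p2, p3, p4, p5⟩
      · rw [d.1]; exact h
      · rw [p5]
        intro z; rw [mem_insert, mem_erase]
        rintro (rfl | ⟨_, a⟩)
        · rcases c with c | c
          · exact absurd (h p3) c
          · exact c _ p1
        · exact h a
    · rw [q5]
      rcases gg_spec s S with ⟨d, d' | d'⟩ | ⟨m', p1, p2, p3, p4, p5⟩
      · rw [d]; intro z hz; rw [mem_insert, mem_erase]
        right; exact ⟨fun e => d' (e ▸ hz), h hz⟩
      · exact absurd (h (d' m q1)) q2
      · rw [p5]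
        intro z; simp only [mem_insert, mem_erase]
        rintro (rfl | ⟨a, b⟩)
        · rcases lt_trichotomy z m with c | c | c
          · exact absurd (h (p4 m c q1)) q2
          · left; exact c
          · right; exact ⟨by omega, q4 z c p1⟩
        · right; exact ⟨a, h b⟩

end Koh

namespace Koh
open Finset MvPolynomial

structure Good (N A : ℕ) (I : (ℕ → Finset ℕ) → Prop) : Prop where
  flag : ∀ u, I u → Flag N A u
  dc : ∀ u v, I u → Flag N A v → fle A v u → I v

def IT (N A k : ℕ) (I : (ℕ → Finset ℕ) → Prop) (T : Finset ℕ) : (ℕ → Finset ℕ) → Prop :=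
  fun v => Flag N A v ∧ ∃ u, I u ∧ u k = T ∧ fle A v (bub k u)

def upI (N A r : ℕ) (I : (ℕ → Finset ℕ) → Prop) : (ℕ → Finset ℕ) → Prop :=
  fun v => Flag N A v ∧ ∃ u, I u ∧ fle A v (fun i => up r (u i))

def dn (N A : ℕ) (x : ℕ → Finset ℕ) : (ℕ → Finset ℕ) → Prop :=
  fun v => Flag N A v ∧ fle A v x

theorem IT_good (N A k : ℕ) (I : (ℕ → Finset ℕ) → Prop) (T : Finset ℕ) :
    Good N A (IT N A k I T) :=
  ⟨fun _ h => h.1, fun _ _ ⟨_, y, h1, h2, h3⟩ hv h => ⟨hv, y, h1, h2, fle_trans h h3⟩⟩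

theorem upI_good (N A r : ℕ) (I : (ℕ → Finset ℕ) → Prop) : Good N A (upI N A r I) :=
  ⟨fun _ h => h.1, fun _ _ ⟨_, y, h1, h2⟩ hv h => ⟨hv, y, h1, fle_trans h h2⟩⟩

theorem dn_good (N A : ℕ) (x : ℕ → Finset ℕ) : Good N A (dn N A x) :=
  ⟨fun _ h => h.1, fun _ _ ⟨_, h1⟩ hv h => ⟨hv, fle_trans h h1⟩⟩

theorem upI_down {N A r : ℕ} {I : (ℕ → Finset ℕ) → Prop} (hI : Good N A I) (hr : r + 1 < N)
    {u : ℕ → Finset ℕ} (hu : upI N A r I u) : I (fun i => down r (u i)) := by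
  obtain ⟨h1, y, h2, h3⟩ := hu
  refine hI.dc y _ h2 (down_op.flag h1) ?_
  have := (down_op (N := N) (r := r)).fle h1 ((up_op hr).flag (hI.flag _ h2)) h3
  intro i hi
  have := this i hi
  simp only [down_up] at this
  exact gle_trans this (down_gle _ _)

theorem upI_of {N A r : ℕ} {I : (ℕ → Finset ℕ) → Prop} (hI : Good N A I)
    {u : ℕ → Finset ℕ} (hu : I u) : upI N A r I u :=
  ⟨hI.flag _ hu, u, hu, fun _ _ => gle_up _ _⟩

theorem upI_up {N A r : ℕ} {I : (ℕ → Finset ℕ) → Prop} (hI : Good N A I) (hr : r + 1 < N)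
    {u : ℕ → Finset ℕ} (hu : I u) : upI N A r I (fun i => up r (u i)) :=
  ⟨(up_op hr).flag (hI.flag _ hu), u, hu, fun _ _ => gle_refl _⟩

theorem bub_up_down {N A k r : ℕ} (hk : k ≤ A) (hr : r + 1 < N) {u : ℕ → Finset ℕ}
    (hu : Flag N (A+1) u) :
    fle A (bub k u) (fun i => up r (bub k (fun i => down r (u i)) i)) := by
  have h1 := (down_op (N := N) (r := r)).bub (k := k) hu
  have h2 := (up_op hr).fle (down_op.flag (bub_flag hu hk))
    (bub_flag (down_op.flag hu) hk) h1
  exact fle_trans (fun i _ => gle_up_down r _) h2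

theorem IT_upI {N A k r : ℕ} {I : (ℕ → Finset ℕ) → Prop} (hI : Good N (A+1) I) (hk : k ≤ A)
    (hr : r + 1 < N) {T T0 : Finset ℕ} (h1 : down r T = T0) (h2 : up r T0 = T) :
    IT N A k (upI N (A+1) r I) T = upI N A r (IT N A k I T0) := by
  funext v; apply propext; constructor
  · rintro ⟨hv, u, hu, hT, hvu⟩
    have hd := upI_down hI hr hu
    have hf := hI.flag _ hd
    refine ⟨hv, bub k (fun i => down r (u i)), ⟨bub_flag hf hk, _, hd, ?_, fle_refl _ _⟩, ?_⟩
    · simp only [hT, h1]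
    · exact fle_trans hvu (bub_up_down hk hr hu.1)
  · rintro ⟨hv, w, ⟨hw, u, hu, hT, hwu⟩, hvw⟩
    have hf := hI.flag _ hu
    refine ⟨hv, _, upI_up hI hr hu, ?_, ?_⟩
    · simp only [hT, h2]
    · exact fle_trans hvw (fle_trans ((up_op hr).fle hw (bub_flag hf hk) hwu) ((up_op hr).bub hf))

theorem IT_open {N A k r : ℕ} {I : (ℕ → Finset ℕ) → Prop} (hI : Good N (A+1) I) (hk : k ≤ A)
    (hr : r + 1 < N) {T : Finset ℕ} (h1 : r ∈ T) (h2 : r + 1 ∉ T) :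
    IT N A k (upI N (A+1) r I) T = IT N A k I T := by
  funext v; apply propext; constructor
  · rintro ⟨hv, u, hu, hT, hvu⟩
    have hd := upI_down hI hr hu
    refine ⟨hv, u, hI.dc _ _ hd hu.1 ?_, hT, hvu⟩
    intro i hi
    have : down r (u i) = u i := by
      apply down_eq
      intro h
      by_cases c : i ≤ k
      · exact absurd (hT ▸ hu.1.mono c (by omega) h) h2
      · exact hu.1.mono (show k ≤ i by omega) hi (hT ▸ h1)
    simp only [this]; exact gle_refl _
  · rintro ⟨hv, u, hu, hT, hvu⟩
    exact ⟨hv, u, upI_of hI hu, hT, hvu⟩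

theorem IT_close {N A k r : ℕ} {I : (ℕ → Finset ℕ) → Prop} (hI : Good N (A+1) I) (hk : k ≤ A)
    (hr : r + 1 < N) {T : Finset ℕ} (h1 : r ∉ T) (h2 : r + 1 ∈ T) :
    upI N A r (IT N A k I T) = IT N A k I T := by
  funext v; apply propext; constructor
  · rintro ⟨hv, w, ⟨hw, u, hu, hT, hwu⟩, hvw⟩
    have hf := hI.flag _ hu
    refine ⟨hv, u, hu, hT, fle_trans hvw ?_⟩
    refine fle_trans ((up_op hr).fle hw (bub_flag hf hk) hwu) ?_
    intro i hi
    have : up r (bub k u i) = bub k u i := by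
      apply up_eq
      intro h
      by_cases c : i ≤ k
      · rw [bub_le c] at h
        exact absurd (hT ▸ hf.mono c (by omega) h) h1
      · exact (bub_between hf (show k ≤ i by omega) hi).1 (hT ▸ h2)
    simp only [this]; exact gle_refl _
  · intro h
    exact upI_of (IT_good _ _ _ _ _) h

noncomputable def mon (T : Finset ℕ) : MvPolynomial ℕ ℤ := ∏ i ∈ T, X (i+1)

open Classical in
noncomputable def G (N : ℕ) : List ℕ → ((ℕ → Finset ℕ) → Prop) → MvPolynomial ℕ ℤ
  | [], I => if ∃ u, I u then 1 else 0
  | k :: ks, I => ∑ T ∈ (range N).powerset, mon T * G N ks (IT N ks.length k I T)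

def OK : List ℕ → Prop
  | [] => True
  | k :: ks => k ≤ ks.length ∧ OK ks

/-- the simple transposition acting on polynomials -/
noncomputable def sg (r : ℕ) : MvPolynomial ℕ ℤ →ₐ[ℤ] MvPolynomial ℕ ℤ :=
  rename (Equiv.swap (r+1) (r+2))

def IsDem (r : ℕ) (f q : MvPolynomial ℕ ℤ) : Prop :=
  (X (r+1) - X (r+2)) * q = X (r+1) * f - sg r (X (r+1) * f)

theorem sg_a (r : ℕ) : sg r (X (r+1)) = X (r+2) := by simp [sg]
theorem sg_b (r : ℕ) : sg r (X (r+2)) = X (r+1) := by simp [sg]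
theorem sg_sg (r : ℕ) (f) : sg r (sg r f) = f := by
  unfold sg; rw [rename_rename]
  have : (⇑(Equiv.swap (r+1) (r+2)) ∘ ⇑(Equiv.swap (r+1) (r+2))) = id := by
    funext x; simp
  rw [this]; simp

theorem isDem_iff (r : ℕ) (f q) : IsDem r f q ↔
    (X (r+1) - X (r+2)) * q = X (r+1) * f - X (r+2) * sg r f := by
  unfold IsDem; rw [map_mul, sg_a]

theorem ab_ne (r : ℕ) : (X (r+1) - X (r+2) : MvPolynomial ℕ ℤ) ≠ 0 := by
  rw [sub_ne_zero]; intro h; have := X_injective h; omega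

theorem IsDem.add {r : ℕ} {f q f' q'} (h : IsDem r f q) (h' : IsDem r f' q') :
    IsDem r (f + f') (q + q') := by
  rw [isDem_iff] at *
  rw [map_add]; linear_combination h + h'

theorem IsDem.sum {r : ℕ} {ι : Type*} (s : Finset ι) {f q : ι → MvPolynomial ℕ ℤ}
    (h : ∀ i ∈ s, IsDem r (f i) (q i)) : IsDem r (∑ i ∈ s, f i) (∑ i ∈ s, q i) := by
  induction s using Finset.cons_induction with
  | empty => simp [IsDem]
  | cons a s ha ih =>
    rw [sum_cons, sum_cons]
    exact (h a (by simp)).add (ih fun i hi => h i (by simp [hi]))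

theorem IsDem.symm_mul {r : ℕ} {f q R} (hR : sg r R = R) (h : IsDem r f q) :
    IsDem r (R * f) (R * q) := by
  rw [isDem_iff] at *
  rw [map_mul, hR]; linear_combination R * h

theorem IsDem.self {r : ℕ} {f} (h : IsDem r f f) : sg r f = f := by
  rw [isDem_iff] at h
  have : (X (r+2) : MvPolynomial ℕ ℤ) * (sg r f - f) = 0 := by linear_combination h
  rcases mul_eq_zero.1 this with h | h
  · exact absurd h (X_ne_zero _)
  · exact sub_eq_zero.1 h

theorem IsDem.pair {r : ℕ} {R H1 H1' H2} (hR : sg r R = R) (h1 : IsDem r H1 H1')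
    (h2 : IsDem r H2 H2) :
    IsDem r (X (r+1) * R * H1 + X (r+2) * R * H2) (X (r+1) * R * H1 + X (r+2) * R * H1') := by
  have h3 := h2.self
  rw [isDem_iff] at *
  simp only [map_add, map_mul, sg_a, sg_b, hR, h3]
  linear_combination (R * X (r+2)) * h1

theorem IsDem.unique {r : ℕ} {f q q'} (h : IsDem r f q) (h' : IsDem r f q') : q = q' := by
  unfold IsDem at *
  exact mul_left_cancel₀ (ab_ne r) (h.trans h'.symm)

theorem IsDem.half {r : ℕ} {f q} (h : IsDem r (f + f) (q + q)) : IsDem r f q := by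
  rw [isDem_iff] at *
  have h2 : (2 : MvPolynomial ℕ ℤ) ≠ 0 := two_ne_zero
  apply mul_left_cancel₀ h2
  rw [map_add] at h
  linear_combination h

theorem sg_mon {r : ℕ} {R : Finset ℕ} (h1 : r ∉ R) (h2 : r+1 ∉ R) : sg r (mon R) = mon R := by
  unfold mon; rw [map_prod]
  apply prod_congr rfl
  intro i hi
  unfold sg
  rw [rename_X, Equiv.swap_apply_of_ne_of_ne]
  · rintro e; apply h1; have : i = r := by omega
    exact this ▸ hi
  · rintro e; apply h2; have : i = r + 1 := by omega
    exact this ▸ hi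

theorem mon_insert {R : Finset ℕ} {r : ℕ} (h : r ∉ R) : mon (insert r R) = X (r+1) * mon R := by
  unfold mon; rw [prod_insert h]

theorem sg_mon_neutral {r : ℕ} {T : Finset ℕ} (h : r ∈ T ↔ r+1 ∈ T) : sg r (mon T) = mon T := by
  by_cases h1 : r ∈ T
  · have h2 := h.1 h1
    have e : T = insert r (insert (r+1) ((T.erase r).erase (r+1))) := by
      rw [insert_erase (by simp [h2]), insert_erase h1]
    rw [e, mon_insert (by simp), mon_insert (by simp), map_mul, map_mul, sg_mon (by simp) (by simp),
      sg_a, sg_b]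
    ring
  · exact sg_mon h1 (fun c => h1 (h.2 c))

def sw (r : ℕ) (T : Finset ℕ) : Finset ℕ := if r ∈ T then up r T else down r T

theorem mem_sw (r : ℕ) (T : Finset ℕ) (z : ℕ) : z ∈ sw r T ↔
    (z ≠ r ∧ z ≠ r+1 ∧ z ∈ T) ∨ (z = r+1 ∧ r ∈ T) ∨ (z = r ∧ r+1 ∈ T) := by
  unfold sw
  split_ifs with h
  · rw [mem_up]
    by_cases h1 : z = r
    · subst h1; simp [h]
    · by_cases h2 : z = r+1
      · subst h2; simp [h]
      · simp [h1, h2]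
  · rw [mem_down]
    by_cases h1 : z = r
    · subst h1; simp [h]
    · by_cases h2 : z = r+1
      · subst h2; simp [h]
      · simp [h1, h2]

theorem sw_sw (r : ℕ) (T : Finset ℕ) : sw r (sw r T) = T := by
  ext z; rw [mem_sw, mem_sw, mem_sw, mem_sw]
  by_cases h1 : z = r
  · subst h1; simp
  · by_cases h2 : z = r+1
    · subst h2; simp
    · simp [h1, h2]

theorem sw_open {r : ℕ} {T : Finset ℕ} (h1 : r ∈ T) (h2 : r+1 ∉ T) :
    sw r T = insert (r+1) (T.erase r) := by
  unfold sw up; rw [if_pos h1, if_pos ⟨h1, h2⟩]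

theorem G_pair {r : ℕ} {T : Finset ℕ} {H H' : Finset ℕ → MvPolynomial ℕ ℤ}
    (h1 : r ∈ T) (h2 : r+1 ∉ T) (e1 : H' T = H T) (e2 : IsDem r (H T) (H' (sw r T)))
    (e3 : IsDem r (H (sw r T)) (H (sw r T))) :
    IsDem r (mon T * H T + mon (sw r T) * H (sw r T))
      (mon T * H' T + mon (sw r T) * H' (sw r T)) := by
  have m1 : mon T = X (r+1) * mon (T.erase r) := by
    rw [← mon_insert (by simp), insert_erase h1]
  have m2 : mon (sw r T) = X (r+2) * mon (T.erase r) := by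
    rw [sw_open h1 h2, mon_insert (by simp [h2])]
  rw [m1, m2, e1]
  exact IsDem.pair (sg_mon (by simp) (by simp [h2])) e2 e3

theorem G_dem {N r : ℕ} (hr : r + 1 < N) : ∀ (ks : List ℕ) (I : (ℕ → Finset ℕ) → Prop), OK ks →
    Good N ks.length I → IsDem r (G N ks I) (G N ks (upI N ks.length r I)) := by
  intro ks
  induction ks with
  | nil =>
    intro I _ hI
    have : (∃ u, upI N 0 r I u) ↔ ∃ u, I u := by
      constructor
      · rintro ⟨u, hu⟩; exact ⟨_, hu.2.choose_spec.1⟩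
      · rintro ⟨u, hu⟩; exact ⟨u, upI_of hI hu⟩
    unfold G
    simp only [List.length_nil, this]
    rw [isDem_iff]
    split_ifs <;> first | (exfalso; tauto) | simp
  | cons k ks ih =>
    intro I hok hI
    obtain ⟨hk, hok⟩ := hok
    simp only [List.length_cons] at hI ⊢
    set A := ks.length with hA
    set H : Finset ℕ → MvPolynomial ℕ ℤ := fun T => G N ks (IT N A k I T) with hH
    set H' : Finset ℕ → MvPolynomial ℕ ℤ := fun T => G N ks (IT N A k (upI N (A+1) r I) T) with hH'
    have k1 : ∀ T, r ∈ T → r + 1 ∉ T → IsDem r (mon T * H T + mon (sw r T) * H (sw r T))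
      (mon T * H' T + mon (sw r T) * H' (sw r T)) := by
      intro T h1 h2
      apply G_pair h1 h2
      · simp only [hH, hH']; rw [IT_open hI hk hr h1 h2]
      · simp only [hH, hH']
        rw [IT_upI hI hk hr (T0 := T)]
        · exact ih _ hok (IT_good _ _ _ _ _)
        · unfold sw; rw [if_pos h1, down_up]; exact down_eq (fun h => absurd h h2)
        · unfold sw; rw [if_pos h1]
      · simp only [hH]
        have := ih (IT N A k I (sw r T)) hok (IT_good _ _ _ _ _)
        rwa [IT_close hI hk hr] at this
        · rw [mem_sw]; simp [h2]
        · rw [mem_sw]; simp [h1]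
    have key : ∀ T, IsDem r (mon T * H T + mon (sw r T) * H (sw r T))
      (mon T * H' T + mon (sw r T) * H' (sw r T)) := by
      intro T
      by_cases h1 : r ∈ T <;> by_cases h2 : r + 1 ∈ T
      · have h3 : IsDem r (mon T * H T) (mon T * H' T) := by
          apply IsDem.symm_mul (sg_mon_neutral (by tauto))
          simp only [hH, hH']
          rw [IT_upI hI hk hr (T0 := T) (down_eq (by tauto)) (up_eq (by tauto))]
          exact ih _ hok (IT_good _ _ _ _ _)
        have : sw r T = T := by unfold sw; rw [if_pos h1, up_eq (by tauto)]
        rw [this]; exact h3.add h3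
      · exact k1 T h1 h2
      · have := k1 (sw r T) (by rw [mem_sw]; simp [h2]) (by rw [mem_sw]; simp [h1])
        rw [sw_sw] at this
        rw [add_comm, add_comm (mon T * H' T)]
        exact this
      · have h3 : IsDem r (mon T * H T) (mon T * H' T) := by
          apply IsDem.symm_mul (sg_mon_neutral (by tauto))
          simp only [hH, hH']
          rw [IT_upI hI hk hr (T0 := T) (down_eq (by tauto)) (up_eq (by tauto))]
          exact ih _ hok (IT_good _ _ _ _ _)
        have : sw r T = T := by unfold sw; rw [if_neg h1, down_eq (by tauto)]
        rw [this]; exact h3.add h3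
    have reidx : ∀ F : Finset ℕ → MvPolynomial ℕ ℤ,
        ∑ T ∈ (range N).powerset, F (sw r T) = ∑ T ∈ (range N).powerset, F T := by
      intro F
      have hb : ∀ T ∈ (range N).powerset, sw r T ∈ (range N).powerset := by
        intro T hT
        rw [mem_powerset] at *
        unfold sw; split_ifs
        · exact (up_op hr).bd _ hT
        · exact down_op.bd _ hT
      exact sum_nbij' (sw r) (sw r) hb hb (fun _ _ => sw_sw _ _) (fun _ _ => sw_sw _ _)
        (fun _ _ => rfl)
    have fin := IsDem.sum (range N).powerset (fun T _ => key T)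
    rw [sum_add_distrib, sum_add_distrib, reidx (fun T => mon T * H T),
      reidx (fun T => mon T * H' T)] at fin
    exact fin.half

end Koh

namespace Koh
open Finset

def Pd (N : ℕ) : List ℕ → ((ℕ → Finset ℕ) → Prop) → (ℕ → Finset ℕ) → Prop
  | [], I, f => (∃ u, I u) ∧ ∀ j, f j = ∅
  | k :: ks, I, f => Pd N ks (IT N ks.length k I (f 0)) (fun j => f (j+1))

theorem Pd_mono {N : ℕ} (ks : List ℕ) : ∀ {I I' : (ℕ → Finset ℕ) → Prop} {f : ℕ → Finset ℕ},
    (∀ u, I u → I' u) → Pd N ks I f → Pd N ks I' f := by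
  induction ks with
  | nil => rintro I I' f h ⟨⟨u, hu⟩, h2⟩; exact ⟨⟨u, h u hu⟩, h2⟩
  | cons k ks ih =>
    intro I I' f h hp
    exact ih (fun v ⟨h1, u, h2, h3, h4⟩ => ⟨h1, u, h u h2, h3, h4⟩) hp

theorem gg_bub {N A k s : ℕ} (hk : k ≤ A) {u v : ℕ → Finset ℕ} (hu : Flag N (A+1) u)
    (hv : Flag N A v) (h : fle A v (bub k u)) :
    fle A (fun i => gg s (v i)) (bub k (fun i => gg s (u i))) :=
  fle_trans ((gg_op N s).fle hv (bub_flag hu hk) h) ((gg_op N s).bub hu)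

theorem Pd_gg {N s : ℕ} (ks : List ℕ) : ∀ {I I' : (ℕ → Finset ℕ) → Prop} {f : ℕ → Finset ℕ},
    OK ks → Good N ks.length I → (∀ u, I u → I' (fun i => gg s (u i))) → (∀ j, s ∉ f j) →
    Pd N ks I f → Pd N ks I' f := by
  induction ks with
  | nil => rintro I I' f _ _ h _ ⟨⟨u, hu⟩, h2⟩; exact ⟨⟨_, h u hu⟩, h2⟩
  | cons k ks ih =>
    intro I I' f hok hI h hs hp
    refine ih hok.2 (IT_good _ _ _ _ _) ?_ (fun j => hs (j+1)) hp
    rintro v ⟨h1, u, h2, h3, h4⟩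
    refine ⟨(gg_op N s).flag h1, _, h u h2, ?_, gg_bub hok.1 (hI.flag _ h2) h1 h4⟩
    simp only [h3]
    exact gg_eq_of_notMem (hs 0)

def KM (f f' : ℕ → Finset ℕ) : Prop :=
  ∃ s c m, s ∈ f c ∧ (∀ c' > c, s ∉ f c') ∧ m < s ∧ m ∉ f c ∧ (∀ i, m < i → i < s → i ∈ f c) ∧
    f' = Function.update f c (insert m ((f c).erase s))

theorem KM_Pd {N : ℕ} (ks : List ℕ) : ∀ {I : (ℕ → Finset ℕ) → Prop} {f f' : ℕ → Finset ℕ},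
    OK ks → Good N ks.length I → KM f f' → Pd N ks I f → Pd N ks I f' := by
  induction ks with
  | nil =>
    rintro I f f' _ _ ⟨s, c, m, h, _⟩ ⟨_, h2⟩
    rw [h2] at h; simp at h
  | cons k ks ih =>
    rintro I f f' hok hI ⟨s, c, m, h1, h2, h3, h4, h5, rfl⟩ hp
    cases c with
    | zero =>
      have e := gg_eq h3 h4 h1 h5
      have e2 : (fun j => Function.update f 0 (insert m ((f 0).erase s)) (j+1))
          = fun j => f (j+1) := by
        funext j; simp
      unfold Pd
      rw [e2, Function.update_self, ← e]
      refine Pd_gg ks (s := s) hok.2 (IT_good _ _ _ _ _) ?_ (fun j => h2 _ (by omega)) hp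
      rintro v ⟨q1, u, q2, q3, q4⟩
      have hf := hI.flag _ q2
      refine ⟨(gg_op N s).flag q1, fun i => gg s (u i),
        hI.dc _ _ q2 ((gg_op N s).flag hf) (fun i _ => gg_gle _ _), ?_, gg_bub hok.1 hf q1 q4⟩
      simp only [q3]
    | succ c =>
      unfold Pd
      rw [Function.update_of_ne (by omega)]
      refine ih (f := fun j => f (j+1)) hok.2 (IT_good _ _ _ _ _) ?_ hp
      refine ⟨s, c, m, h1, fun c' hc => h2 _ (by omega), h3, h4, h5, ?_⟩
      funext j
      by_cases hj : j = c
      · subst hj; simp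
      · rw [Function.update_of_ne hj, Function.update_of_ne (by omega)]

theorem Pd_split {N : ℕ} (ks : List ℕ) : ∀ {I : (ℕ → Finset ℕ) → Prop} {f : ℕ → Finset ℕ},
    Good N ks.length I → Pd N ks I f → ∃ u, I u ∧ Pd N ks (dn N ks.length u) f := by
  induction ks with
  | nil =>
    rintro I f hI ⟨⟨u, hu⟩, h2⟩
    exact ⟨u, hu, ⟨u, hI.flag _ hu, fle_refl _ _⟩, h2⟩
  | cons k ks ih =>
    rintro I f hI hp
    obtain ⟨v, ⟨h1, u, h2, h3, h4⟩, h5⟩ := ih (IT_good _ _ _ _ _) hp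
    refine ⟨u, h2, Pd_mono ks ?_ h5⟩
    rintro w ⟨w1, w2⟩
    exact ⟨w1, u, ⟨hI.flag _ h2, fle_refl _ _⟩, h3, fle_trans w2 h4⟩

theorem Pd_bd {N : ℕ} (ks : List ℕ) : ∀ {I : (ℕ → Finset ℕ) → Prop} {f : ℕ → Finset ℕ},
    OK ks → Good N ks.length I → Pd N ks I f →
    (∀ j, f j ⊆ range N) ∧ ∀ j, ks.length ≤ j → f j = ∅ := by
  induction ks with
  | nil =>
    rintro I f _ hI ⟨_, h2⟩
    exact ⟨fun j => by simp [h2], fun j _ => h2 j⟩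
  | cons k ks ih =>
    rintro I f hok hI hp
    obtain ⟨h1, h2⟩ := ih hok.2 (IT_good _ _ _ _ _) hp
    obtain ⟨v, ⟨_, u, h3, h4, _⟩, _⟩ := Pd_split ks (IT_good _ _ _ _ _) hp
    constructor
    · intro j
      cases j with
      | zero => rw [← h4]; exact (hI.flag _ h3).bd k (by have := hok.1; simp; omega)
      | succ j => exact h1 j
    · intro j hj
      cases j with
      | zero => simp at hj
      | succ j => exact h2 j (by simpa using hj)

def AP (N : ℕ) : List ℕ → (ℕ → Finset ℕ) → (ℕ → Finset ℕ) → Prop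
  | [], _, f => ∀ j, f j = ∅
  | k :: ks, x, f => ∃ u, Flag N (ks.length+1) u ∧ fle (ks.length+1) u x ∧
      u (ks.length+1) = x (ks.length+1) ∧ f 0 = u k ∧ AP N ks (bub k u) (fun j => f (j+1))

theorem AP_sub {N : ℕ} (ks : List ℕ) : ∀ {x f : ℕ → Finset ℕ}, OK ks → Flag N ks.length x →
    AP N ks x f → ∀ j, f j ⊆ x ks.length := by
  induction ks with
  | nil => intro x f _ _ h j; rw [h j]; simp
  | cons k ks ih =>
    rintro x f ⟨hk, hok⟩ hx ⟨u, h1, h2, h3, h4, h5⟩ j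
    rw [List.length_cons, ← h3]
    cases j with
    | zero => rw [h4]; exact h1.mono (by omega) le_rfl
    | succ j => exact (ih hok (bub_flag h1 hk) h5 j).trans (bub_between h1 hk le_rfl).2.1

theorem lemL {N A : ℕ} {u x : ℕ → Finset ℕ} (hu : Flag N A u) (hx : Flag N A x) (hux : fle A u x)
    (hne : u A ≠ x A) : ∃ a b u', Flag N A u' ∧ fle A u' x ∧ fle A u u' ∧ a < b ∧ a ∈ u A ∧
      b ∉ u A ∧ (∀ i ≤ A, a ∈ u i → ∀ z, a < z → z < b → z ∈ u i) ∧
      (∀ i, u' i = if a ∈ u i then insert b ((u i).erase a) else u i) := by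
  have he : ∃ e ∈ u A, e ∉ x A := by
    by_contra hc
    push Not at hc
    exact hne (eq_of_subset_of_card_le hc (by rw [hu.card A le_rfl, hx.card A le_rfl]))
  obtain ⟨e, e1, e2⟩ := he
  have hb : ∃ b, e < b ∧ b ∉ u A := by
    refine ⟨max (e+1) N, by omega, fun h => ?_⟩
    have := hu.bd A le_rfl h
    simp at this
  classical
  obtain ⟨b, ⟨b1, b2⟩, b3⟩ : ∃ b, (e < b ∧ b ∉ u A) ∧ ∀ z, e ≤ z → z < b → z ∈ u A := by
    refine ⟨Nat.find hb, Nat.find_spec hb, fun z h1 h2 => ?_⟩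
    have := Nat.find_min hb h2
    rcases eq_or_lt_of_le h1 with h1 | h1
    · rw [← h1]; exact e1
    · tauto
  have hj : ∃ j, j ≤ A ∧ ∀ z, e ≤ z → z < b → z ∈ u j := ⟨A, le_rfl, b3⟩
  obtain ⟨j, ⟨j1, j2⟩, j3⟩ : ∃ j, (j ≤ A ∧ ∀ z, e ≤ z → z < b → z ∈ u j) ∧
      ∀ i < j, ¬ (i ≤ A ∧ ∀ z, e ≤ z → z < b → z ∈ u i) :=
    ⟨Nat.find hj, Nat.find_spec hj, fun i hi => Nat.find_min hj hi⟩
  have hj0 : j ≠ 0 := by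
    rintro rfl
    have h1 := j2 e le_rfl b1
    have h2 := hu.card 0 (by omega)
    rw [card_eq_zero] at h2
    rw [h2] at h1; simp at h1
  have h := j3 (j-1) (by omega)
  push Not at h
  obtain ⟨a, a1, a2, a3⟩ := h (by omega)
  have ha : ∀ i ≤ A, a ∈ u i → j ≤ i := by
    intro i hi h
    by_contra hc
    exact a3 (hu.mono (by omega) (by omega) h)
  have hnb : ∀ i ≤ A, b ∉ u i := fun i hi h => b2 (hu.mono hi le_rfl h)
  let u' : ℕ → Finset ℕ := fun i => if a ∈ u i then insert b ((u i).erase a) else u i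
  have hrk : ∀ i ≤ A, a ∈ u i → ∀ t, rk (u' i) t = rk (u i) t + if a < t ∧ t ≤ b then 1 else 0 := by
    intro i hi h t
    simp only [u', h, if_true]
    have := rk_erase (u i) a t h
    rw [rk_insert _ _ _ (by simp [hnb i hi])]
    split_ifs at * <;> omega
  have hux' : fle A u' x := by
    intro i hi
    by_cases h : a ∈ u i
    · intro t
      rw [hrk i hi h]
      have g1 := hux i hi t
      split_ifs with c
      · have h1 := rk_split_full (u i) (s := e) (t := t) (by omega)
          (fun z z1 z2 => hu.mono (ha i hi h) hi (j2 z z1 (by omega)))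
        have h2 := rk_split_miss (x i) (s := e) (t := t) (m := e) (by omega)
          (fun h => e2 (hx.mono hi le_rfl h)) le_rfl (by omega)
        have := hux i hi e
        omega
      · omega
    · simp only [u', h, if_false]; exact hux i hi
  refine ⟨a, b, u', ⟨?_, ?_, ?_⟩, hux', ?_, a2, hu.mono j1 le_rfl (j2 a a1 a2), b2, ?_, fun i => rfl⟩
  · intro i hi
    by_cases h : a ∈ u i
    · simp only [u', h, if_true]
      rw [card_insert_of_notMem (by simp [hnb i hi]), card_erase_of_mem h]
      have := card_pos.2 ⟨a, h⟩
      have := hu.card i hi; omega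
    · simp only [u', h, if_false]; exact hu.card i hi
  · intro i hi
    have hs := hu.sub i hi
    by_cases h : a ∈ u i
    · simp only [u', h, hs h, if_true]
      exact insert_subset_insert _ (erase_subset_erase _ hs)
    · by_cases h' : a ∈ u (i+1)
      · simp only [u', h, h', if_true, if_false]
        intro z hz
        simp only [mem_insert, mem_erase]
        right; exact ⟨fun e => h (e ▸ hz), hs hz⟩
      · simp only [u', h, h', if_false]; exact hs
  · intro i hi; exact sub_range_of_gle (hux' i hi) (hx.bd i hi)
  · intro i hi
    by_cases h : a ∈ u i
    · intro t; rw [hrk i hi h]; omega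
    · simp only [u', h, if_false]; exact gle_refl _
  · intro i hi h z z1 z2
    exact hu.mono (ha i hi h) hi (j2 z (by omega) z2)

def fwt (A : ℕ) (u : ℕ → Finset ℕ) : ℕ := ∑ i ∈ range A, ∑ z ∈ u i, z

theorem sum_move {S : Finset ℕ} {a b : ℕ} (h1 : a ∈ S) (h2 : b ∉ S) :
    ∑ z ∈ insert b (S.erase a), z + a = ∑ z ∈ S, z + b := by
  rw [sum_insert (by simp [h2]), ← add_sum_erase S (fun z => z) h1]; ring

theorem fwt_bd {N A : ℕ} {u : ℕ → Finset ℕ} (h : ∀ i < A, u i ⊆ range N) :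
    fwt A u ≤ A * ∑ z ∈ range N, z := by
  unfold fwt
  calc _ ≤ ∑ i ∈ range A, ∑ z ∈ range N, z :=
        sum_le_sum fun i hi => sum_le_sum_of_subset (h i (by simpa using hi))
    _ = _ := by simp

theorem propC {N : ℕ} (ks : List ℕ) : ∀ {x f : ℕ → Finset ℕ}, OK ks → Flag N ks.length x →
    Pd N ks (dn N ks.length x) f →
    AP N ks x f ∨ ∃ f', KM f' f ∧ Pd N ks (dn N ks.length x) f' := by
  induction ks with
  | nil => rintro x f _ _ ⟨_, h⟩; left; exact h
  | cons k ks ih =>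
    rintro x f ⟨hk, hok⟩ hx hp
    simp only [List.length_cons] at hx hp ⊢
    set A := ks.length with hA
    have lift : ∀ (u f' : ℕ → Finset ℕ), Flag N (A+1) u → fle (A+1) u x → u k = f' 0 →
        Pd N ks (dn N A (bub k u)) (fun j => f' (j+1)) →
        Pd N (k :: ks) (dn N (A+1) x) f' := by
      intro u f' hu hux h0 h
      refine Pd_mono ks ?_ h
      rintro v ⟨v1, v2⟩
      exact ⟨v1, u, ⟨hu, hux⟩, h0, v2⟩
    have main : ∀ n, ∀ u, (A+2) * (∑ z ∈ range N, z) - fwt (A+2) u = n → Flag N (A+1) u →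
        fle (A+1) u x → u k = f 0 → Pd N ks (dn N A (bub k u)) (fun j => f (j+1)) →
        AP N (k :: ks) x f ∨ ∃ f', KM f' f ∧ Pd N (k :: ks) (dn N (A+1) x) f' := by
      intro n
      induction n using Nat.strong_induction_on with
      | _ n ihn =>
        intro u hn hu hux h0 h
        rcases ih hok (bub_flag hu hk) h with hap | ⟨g, hg1, hg2⟩
        · by_cases heq : u (A+1) = x (A+1)
          · left; exact ⟨u, hu, hux, heq, h0.symm, hap⟩
          · obtain ⟨a, b, u', q1, q2, q3, q4, q5, q6, q7, q8⟩ := lemL hu hx hux heq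
            have hpd : Pd N ks (dn N A (bub k u')) (fun j => f (j+1)) := by
              refine Pd_mono ks ?_ h
              rintro v ⟨v1, v2⟩
              exact ⟨v1, fle_trans v2 (bub_mono hu q1 hk q3)⟩
            by_cases hak : a ∈ u k
            · right
              have e' : u' k = insert b ((f 0).erase a) := by rw [q8, if_pos hak, h0]
              have hbk : b ∉ f 0 := by
                rw [← h0]; exact fun h => q6 (hu.mono (by omega) le_rfl h)
              refine ⟨Function.update f 0 (u' k), ⟨b, 0, a, ?_, ?_, q4, ?_, ?_, ?_⟩, ?_⟩
              · rw [Function.update_self, e']; simp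
              · intro c hc
                rw [Function.update_of_ne (by omega)]
                intro hb
                obtain ⟨c, rfl⟩ : ∃ d, c = d + 1 := ⟨c - 1, by omega⟩
                exact q6 ((bub_between hu hk le_rfl).2.1
                  (AP_sub ks hok (bub_flag hu hk) hap c hb))
              · rw [Function.update_self, e']; simp; omega
              · intro i i1 i2
                rw [Function.update_self, e']
                simp only [mem_insert, mem_erase]
                right
                exact ⟨by omega, h0 ▸ q7 k (by omega) hak i i1 i2⟩
              · funext c
                by_cases hc : c = 0
                · subst hc
                  rw [Function.update_self, Function.update_self, e',
                    erase_insert (by simp [hbk]), insert_erase (h0 ▸ hak)]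
                · rw [Function.update_of_ne hc, Function.update_of_ne hc]
              · refine lift u' _ q1 q2 (by simp) ?_
                simpa using hpd
            · refine ihn _ ?_ u' rfl q1 q2 (by rw [q8, if_neg hak, h0]) hpd
              have hlt : fwt (A+2) u < fwt (A+2) u' := by
                unfold fwt
                apply sum_lt_sum
                · intro i hi
                  rw [mem_range] at hi
                  rw [q8]; split_ifs with c
                  · have := sum_move c (fun h => q6 (hu.mono (show i ≤ A+1 by omega) le_rfl h))
                    omega
                  · exact le_rfl
                · refine ⟨A+1, by simp, ?_⟩
                  rw [q8, if_pos q5]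
                  have := sum_move q5 q6
                  omega
              have := fwt_bd (A := A+2) (u := u') (N := N) (fun i hi => q1.bd i (by omega))
              omega
        · right
          refine ⟨fun j => if j = 0 then f 0 else g (j-1), ?_, ?_⟩
          · obtain ⟨s, c, m, p1, p2, p3, p4, p5, p6⟩ := hg1
            refine ⟨s, c+1, m, by simpa using p1, ?_, p3, by simpa using p4, by simpa using p5, ?_⟩
            · intro c' hc
              dsimp only
              rw [if_neg (by omega)]
              exact p2 _ (by omega)
            · funext j
              cases j with
              | zero => rw [Function.update_of_ne (by omega)]; simp
              | succ j =>
                have := congrFun p6 j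
                rw [this]
                by_cases hj : j = c
                · subst hj; simp
                · rw [Function.update_of_ne hj, Function.update_of_ne (by omega)]; simp
          · exact lift u _ hu hux (by simpa using h0) (by simpa using hg2)
    obtain ⟨v, ⟨h1, u, ⟨h2, h2'⟩, h3, h4⟩, h5⟩ := Pd_split ks (IT_good _ _ _ _ _) hp
    refine main _ u rfl h2 h2' h3 (Pd_mono ks ?_ h5)
    rintro w ⟨w1, w2⟩
    exact ⟨w1, fle_trans w2 h4⟩

theorem reach {N : ℕ} (ks : List ℕ) {x : ℕ → Finset ℕ} (hok : OK ks) (hx : Flag N ks.length x) :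
    ∀ n f, ks.length * (∑ z ∈ range N, z) - fwt ks.length f = n →
    Pd N ks (dn N ks.length x) f → ∃ f0, AP N ks x f0 ∧ Relation.ReflTransGen KM f0 f := by
  intro n
  induction n using Nat.strong_induction_on with
  | _ n ihn =>
    intro f hn hp
    rcases propC ks hok hx hp with h | ⟨f', h1, h2⟩
    · exact ⟨f, h, .refl⟩
    · obtain ⟨b1, b2⟩ := Pd_bd ks hok (dn_good _ _ _) h2
      obtain ⟨f0, h3, h4⟩ := ihn _ (by
        have hlt : fwt ks.length f < fwt ks.length f' := by
          obtain ⟨s, c, m, p1, p2, p3, p4, p5, rfl⟩ := h1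
          have hc : c < ks.length := by
            by_contra hc
            rw [b2 c (by omega)] at p1; simp at p1
          have := sum_move p1 p4
          unfold fwt
          apply sum_lt_sum
          · intro i _
            by_cases hi : i = c
            · subst hi; rw [Function.update_self]; omega
            · rw [Function.update_of_ne hi]
          · exact ⟨c, by simpa using hc, by rw [Function.update_self]; omega⟩
        have := fwt_bd (A := ks.length) (u := f') (N := N) (fun i hi => b1 i)
        omega) f' rfl h2
      exact ⟨f0, h3, h4.tail h1⟩

def skip (k i : ℕ) : ℕ := if i < k then i else i + 1

theorem skip_mono (k : ℕ) : StrictMono (skip k) := by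
  intro i j h; unfold skip; split_ifs <;> omega

def topf : List ℕ → (ℕ → ℕ) → ℕ → Finset ℕ
  | [], _, _ => ∅
  | k :: _, ι, 0 => (range k).image ι
  | k :: ks, ι, j+1 => topf ks (ι ∘ skip k) j

theorem bub_std {N A k : ℕ} {x : ℕ → Finset ℕ} {ι : ℕ → ℕ} (hι : StrictMono ι)
    (hx : Flag N (A+1) x) (h : ∀ i ≤ A+1, x i = (range i).image ι) (hk : k ≤ A) :
    ∀ i ≤ A, bub k x i = (range i).image (ι ∘ skip k) := by
  intro i hi
  by_cases c : i ≤ k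
  · rw [bub_le c, h i (by omega)]
    apply image_congr
    intro z hz
    simp only [coe_range, Set.mem_Iio] at hz
    simp only [Function.comp, skip]; rw [if_pos (by omega)]
  · obtain ⟨m, h1, h2, h3, h4⟩ := bub_gt hx (show k < i by omega) hi
    rw [h _ (by omega)] at h1 h3 h4
    rw [h _ (by omega)] at h2 h3
    have hm : m = ι k := by
      have l1 := h3 (ι k) (by simp [hι.injective.eq_iff]; omega) (by simp [hι.injective.eq_iff])
      simp only [mem_image, mem_range] at h1
      obtain ⟨p, p1, rfl⟩ := h1
      simp [hι.injective.eq_iff] at h2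
      have := hι.monotone h2
      omega
    rw [h4, hm]
    ext z
    simp only [mem_erase, mem_image, mem_range, Function.comp, skip]
    constructor
    · rintro ⟨z1, p, p1, rfl⟩
      have : p ≠ k := fun e => z1 (by rw [e])
      by_cases hp : p < k
      · exact ⟨p, by omega, by rw [if_pos hp]⟩
      · exact ⟨p-1, by omega, by rw [if_neg (by omega)]; congr 1; omega⟩
    · rintro ⟨p, p1, rfl⟩
      refine ⟨?_, (if p < k then p else p+1), by split_ifs <;> omega, rfl⟩
      rw [Ne, hι.injective.eq_iff]; split_ifs <;> omega

theorem AP_unique {N : ℕ} (ks : List ℕ) : ∀ {x f : ℕ → Finset ℕ} {ι : ℕ → ℕ}, StrictMono ι →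
    OK ks → (∀ i ≤ ks.length, x i = (range i).image ι) → AP N ks x f → f = topf ks ι := by
  induction ks with
  | nil => intro x f ι _ _ _ h; funext j; rw [h j]; rfl
  | cons k ks ih =>
    rintro x f ι hι ⟨hk, hok⟩ hx ⟨u, h1, h2, h3, h4, h5⟩
    rw [List.length_cons] at hx
    have hu : ∀ i ≤ ks.length + 1, u i = (range i).image ι := by
      intro i hi
      have hsub : u i ⊆ (range i).image ι := by
        intro z hz
        have := h1.mono hi le_rfl hz
        rw [h3, hx _ le_rfl] at this
        simp only [mem_image, mem_range] at this ⊢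
        obtain ⟨m, m1, rfl⟩ := this
        by_contra hc
        have hm : i ≤ m := by
          by_contra hmi; exact hc ⟨m, by omega, rfl⟩
        have l := h2 i hi (ι m)
        rw [hx i hi] at l
        have l0 : rk ((range i).image ι) (ι m) = 0 := by
          unfold rk; rw [card_eq_zero, filter_eq_empty_iff]
          intro z hz
          simp only [mem_image, mem_range] at hz
          obtain ⟨p, p1, rfl⟩ := hz
          rw [not_le]; exact hι (by omega)
        have l1 : 0 < rk (u i) (ι m) := card_pos.2 ⟨ι m, by simp [hz]⟩
        omega
      apply eq_of_subset_of_card_le hsub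
      rw [card_image_of_injective _ hι.injective, card_range, h1.card i hi]
    have e := ih (hι.comp (skip_mono k)) hok (bub_std hι h1 hu hk) h5
    funext j
    cases j with
    | zero => rw [h4, hu k (by omega)]; rfl
    | succ j => exact congrFun e j

theorem Pd_top {N : ℕ} (ks : List ℕ) : ∀ {x : ℕ → Finset ℕ} {ι : ℕ → ℕ}, StrictMono ι →
    OK ks → Flag N ks.length x → (∀ i ≤ ks.length, x i = (range i).image ι) →
    Pd N ks (dn N ks.length x) (topf ks ι) := by
  induction ks with
  | nil => intro x ι _ _ hx _; exact ⟨⟨x, hx, fle_refl _ _⟩, fun j => rfl⟩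
  | cons k ks ih =>
    rintro x ι hι ⟨hk, hok⟩ hx h
    rw [List.length_cons] at h hx
    have := ih (hι.comp (skip_mono k)) hok (bub_flag hx hk) (bub_std hι hx h hk)
    refine Pd_mono ks ?_ this
    rintro v ⟨v1, v2⟩
    exact ⟨v1, x, ⟨hx, fle_refl _ _⟩, h k (by omega), v2⟩

/-- the reachable column functions are exactly those satisfying the predicate. -/
theorem reach_iff {N : ℕ} (ks : List ℕ) (hok : OK ks) (hN : ks.length ≤ N) (f : ℕ → Finset ℕ) :
    Relation.ReflTransGen KM (topf ks id) f ↔ Pd N ks (dn N ks.length range) f := by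
  have hfl : Flag N ks.length range := ⟨fun i _ => card_range i,
    fun i _ => range_mono (by omega), fun i hi => range_mono (by omega)⟩
  constructor
  · intro h
    induction h with
    | refl => exact Pd_top ks strictMono_id hok hfl (by simp)
    | tail _ h ih => exact KM_Pd ks hok (dn_good _ _ _) h ih
  · intro h
    obtain ⟨f0, h1, h2⟩ := reach ks hok hfl _ f rfl h
    rwa [AP_unique ks strictMono_id hok (by simp) h1] at h2

end Koh

namespace Koh
open Finset MvPolynomial

theorem G_empty {N : ℕ} (ks : List ℕ) : ∀ {I : (ℕ → Finset ℕ) → Prop}, (∀ u, ¬ I u) →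
    G N ks I = 0 := by
  induction ks with
  | nil => intro I h; unfold G; rw [if_neg]; rintro ⟨u, hu⟩; exact h u hu
  | cons k ks ih =>
    intro I h
    unfold G
    apply sum_eq_zero
    intro T _
    rw [ih, mul_zero]
    rintro v ⟨_, u, hu, _⟩
    exact h u hu

theorem range_flag {N A : ℕ} (hN : A ≤ N) : Flag N A range := ⟨fun i _ => card_range i,
    fun i _ => range_mono (by omega), fun i hi => range_mono (by omega)⟩

theorem eq_range {N A : ℕ} {u : ℕ → Finset ℕ} (hu : Flag N A u) (h : fle A u range) :
    ∀ i ≤ A, u i = range i := by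
  intro i hi
  apply eq_of_subset_of_card_le (sub_range_of_gle (h i hi) subset_rfl)
  rw [card_range, hu.card i hi]

/-- the flag obtained from the standard one by skipping `k`. -/
def Bk (k i : ℕ) : Finset ℕ := (range i).image (skip k)

theorem mem_Bk (k i z : ℕ) : z ∈ Bk k i ↔ (z < k ∧ z < i) ∨ (k < z ∧ z < i + 1) := by
  unfold Bk skip
  simp only [mem_image, mem_range]
  constructor
  · rintro ⟨p, hp, rfl⟩; split_ifs <;> omega
  · rintro (h | h)
    · exact ⟨z, h.2, if_pos h.1⟩
    · exact ⟨z-1, by omega, by rw [if_neg (by omega)]; omega⟩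

theorem up_Bk (r i : ℕ) : up r (Bk (r+1) i) = Bk r i := by
  ext z
  rw [mem_up, mem_Bk, mem_Bk, mem_Bk, mem_Bk]
  omega

theorem Bk_flag {N A : ℕ} (k : ℕ) (hN : A + 1 ≤ N) : Flag N A (Bk k) where
  card i _ := by unfold Bk; rw [card_image_of_injective _ (skip_mono k).injective, card_range]
  sub i _ := image_subset_image (range_mono (by omega))
  bd i _ z hz := by rw [mem_Bk] at hz; rw [mem_range]; omega

theorem upI_dn {N A r : ℕ} (hr : r + 1 < N) {x : ℕ → Finset ℕ} (hx : Flag N A x) :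
    upI N A r (dn N A x) = dn N A (fun i => up r (x i)) := by
  funext v; apply propext; constructor
  · rintro ⟨hv, u, ⟨hu, hux⟩, hvu⟩
    exact ⟨hv, fle_trans hvu ((up_op hr).fle hu hx hux)⟩
  · rintro ⟨hv, h⟩
    exact ⟨hv, x, ⟨hx, fle_refl _ _⟩, h⟩

theorem dn_congr {N A : ℕ} {x y : ℕ → Finset ℕ} (h : ∀ i ≤ A, x i = y i) : dn N A x = dn N A y := by
  funext v; apply propext; unfold dn fle
  refine and_congr Iff.rfl (forall_congr' fun i => forall_congr' fun hi => ?_)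
  rw [h i hi]

theorem G_step {N r : ℕ} (ks : List ℕ) (hok : OK ks) (hN : ks.length + 1 ≤ N)
    (hr : r < ks.length) : IsDem r (G N ks (dn N ks.length (Bk (r+1))))
      (G N ks (dn N ks.length (Bk r))) := by
  have := G_dem (show r + 1 < N by omega) ks _ hok (dn_good N ks.length (Bk (r+1)))
  rw [upI_dn (by omega) (Bk_flag _ hN)] at this
  simpa only [up_Bk] using this

theorem G_base {N : ℕ} (ks : List ℕ) :
    G N ks (dn N ks.length (Bk ks.length)) = G N ks (dn N ks.length range) := by
  congr 1
  apply dn_congr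
  intro i hi; ext z; rw [mem_Bk, mem_range]; omega

theorem G_cons {N k : ℕ} (ks : List ℕ) (hk : k ≤ ks.length) (hN : ks.length + 1 ≤ N) :
    G N (k :: ks) (dn N (ks.length+1) range) = mon (range k) * G N ks (dn N ks.length (Bk k)) := by
  have hb : ∀ i ≤ ks.length, bub k range i = Bk k i := by
    have := bub_std (N := N) strictMono_id (range_flag hN) (by simp) hk
    intro i hi; rw [this i hi]; rfl
  rw [G, sum_eq_single (range k)]
  · congr 2
    funext v; apply propext; constructor
    · rintro ⟨hv, u, ⟨hu, hux⟩, _, h⟩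
      refine ⟨hv, fle_trans h ?_⟩
      have := bub_mono hu (range_flag hN) hk hux
      intro i hi; rw [← hb i hi]; exact this i hi
    · rintro ⟨hv, h⟩
      refine ⟨hv, range, ⟨range_flag hN, fle_refl _ _⟩, rfl, ?_⟩
      intro i hi; rw [hb i hi]; exact h i hi
  · intro T _ hT
    rw [G_empty, mul_zero]
    rintro v ⟨_, u, ⟨hu, hux⟩, h, _⟩
    exact hT (by rw [← h, eq_range hu hux k (by omega)])
  · intro h
    exfalso; apply h; rw [mem_powerset]; exact range_mono (by omega)

/-! ### permutations -/

def ins {n : ℕ} (k : Fin (n+1)) (v : Equiv.Perm (Fin n)) : Equiv.Perm (Fin (n+1)) :=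
  (finSuccEquiv' k).trans ((Equiv.optionCongr v).trans (finSuccEquiv' 0).symm)

theorem ins_self {n : ℕ} (k : Fin (n+1)) (v : Equiv.Perm (Fin n)) : ins k v k = 0 := by
  simp [ins]

theorem ins_succAbove {n : ℕ} (k : Fin (n+1)) (v : Equiv.Perm (Fin n)) (i : Fin n) :
    ins k v (k.succAbove i) = (v i).succ := by
  simp [ins]

theorem ins_surj {n : ℕ} (w : Equiv.Perm (Fin (n+1))) : ∃ k v, w = ins k v := by
  set k := w.symm 0 with hk
  have hne : ∀ i, w (k.succAbove i) ≠ 0 := by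
    intro i h
    have : k.succAbove i = k := by rw [hk, Equiv.eq_symm_apply, ← hk, h]
    exact Fin.succAbove_ne k i this
  let g : Fin n → Fin n := fun i => (w (k.succAbove i)).pred (hne i)
  have hg : Function.Injective g := by
    intro i j h
    have := Fin.pred_inj.1 h
    exact Fin.succAbove_right_injective (w.injective this)
  refine ⟨k, Equiv.ofBijective g (Finite.injective_iff_bijective.1 hg), ?_⟩
  ext x
  congr 1
  rcases Fin.eq_self_or_eq_succAbove k x with h | ⟨i, h⟩
  · rw [h, ins_self, hk]; simp
  · rw [h, ins_succAbove]
    simp [g]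

theorem succAbove_val {n : ℕ} (k : Fin (n+1)) (i : Fin n) :
    ((k.succAbove i : Fin (n+1)) : ℕ) = skip k i := by
  unfold Fin.succAbove skip
  simp only [Fin.lt_def, Fin.val_castSucc]
  split_ifs <;> simp

theorem ins_swap {n : ℕ} (k : Fin n) (v : Equiv.Perm (Fin n)) :
    ins k.castSucc v * Equiv.swap k.castSucc k.succ = ins k.succ v := by
  apply Equiv.ext
  intro x
  rw [Equiv.Perm.mul_apply]
  rcases Fin.eq_self_or_eq_succAbove k.succ x with h | ⟨i, h⟩
  · rw [h, ins_self, Equiv.swap_apply_right, ins_self]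
  · rw [h, ins_succAbove]
    rw [← ins_succAbove k.castSucc v i]
    congr 1
    have hv := succAbove_val k.succ i
    have hv' := succAbove_val k.castSucc i
    apply Fin.ext
    rw [hv']
    unfold skip at hv hv'
    unfold skip
    simp only [Fin.val_succ, Fin.val_castSucc] at *
    by_cases c : (i : ℕ) = k
    · have : k.succ.succAbove i = k.castSucc := by
        apply Fin.ext; rw [hv]; simp; split_ifs <;> omega
      rw [this, Equiv.swap_apply_left]
      simp; split_ifs <;> omega
    · rw [Equiv.swap_apply_of_ne_of_ne]
      · rw [hv]; split_ifs <;> omega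
      · intro e; have := congrArg Fin.val e; rw [hv] at this; simp at this; split_ifs at this <;> omega
      · intro e; have := congrArg Fin.val e; rw [hv] at this; simp at this; split_ifs at this <;> omega

theorem ins_last_mul {n : ℕ} (v : Equiv.Perm (Fin n)) (i j : Fin n) :
    ins (Fin.last n) (v * Equiv.swap i j) =
      ins (Fin.last n) v * Equiv.swap i.castSucc j.castSucc := by
  apply Equiv.ext
  intro x
  rw [Equiv.Perm.mul_apply]
  rcases Fin.eq_self_or_eq_succAbove (Fin.last n) x with h | ⟨z, h⟩
  · rw [h, ins_self, Equiv.swap_apply_of_ne_of_ne, ins_self]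
    · exact (Fin.castSucc_lt_last i).ne'
    · exact (Fin.castSucc_lt_last j).ne'
  · rw [h, ins_succAbove, Fin.succAbove_last, ← (Fin.castSucc_injective n).map_swap,
      Equiv.Perm.mul_apply, ← Fin.succAbove_last_apply, ins_succAbove]

theorem ins_last_rev {n : ℕ} : ins (Fin.last n) Fin.revPerm = (Fin.revPerm : Equiv.Perm (Fin (n+1))) := by
  apply Equiv.ext
  intro x
  rcases Fin.eq_self_or_eq_succAbove (Fin.last n) x with h | ⟨z, h⟩
  · rw [h, ins_self]; simp
  · rw [h, ins_succAbove]
    apply Fin.ext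
    simp [Fin.val_rev]
    omega

theorem dvd_sub_sg (r : ℕ) (f : MvPolynomial ℕ ℤ) :
    (X (r+1) - X (r+2) : MvPolynomial ℕ ℤ) ∣ f - sg r f := by
  induction f using MvPolynomial.induction_on with
  | C a => simp [sg]
  | add p q hp hq =>
    rw [map_add]
    have := dvd_add hp hq
    convert this using 1; ring
  | mul_X p k hp =>
    rw [map_mul]
    have hX : (X (r+1) - X (r+2) : MvPolynomial ℕ ℤ) ∣ X k - sg r (X k) := by
      by_cases h1 : k = r+1
      · rw [h1, sg_a]
      · by_cases h2 : k = r+2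
        · rw [h2, sg_b]; exact ⟨-1, by ring⟩
        · unfold sg; rw [rename_X, Equiv.swap_apply_of_ne_of_ne h1 h2, sub_self]; exact dvd_zero _
    have := dvd_add (Dvd.dvd.mul_right hp (X k)) (Dvd.dvd.mul_right hX (sg r p))
    convert this using 1; ring

def pm {n : ℕ} (v : Equiv.Perm (Fin n)) : ℕ := ∑ x : Fin n, (x : ℕ) * (v x : ℕ)

theorem pm_lt {n : ℕ} (v : Equiv.Perm (Fin n)) (i : Fin n) (h : (i : ℕ) + 1 < n)
    (hv : v i < v ⟨(i : ℕ) + 1, h⟩) : pm (v * Equiv.swap i ⟨(i : ℕ) + 1, h⟩) < pm v := by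
  set j : Fin n := ⟨(i : ℕ) + 1, h⟩ with hj
  have hij : i ≠ j := by intro e; have := congrArg Fin.val e; simp [hj] at this
  unfold pm
  have e1 : ∑ x : Fin n, (x : ℕ) * ((v * Equiv.swap i j) x : ℕ) =
      ∑ x : Fin n, (Equiv.swap i j x : ℕ) * (v x : ℕ) := by
    rw [← Equiv.sum_comp (Equiv.swap i j)]
    apply sum_congr rfl
    intro x _
    simp [Equiv.Perm.mul_apply]
  rw [e1]
  zify
  rw [← sub_pos, ← sum_sub_distrib, Fintype.sum_eq_add i j hij]
  · rw [Equiv.swap_apply_left, Equiv.swap_apply_right]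
    have : (j : ℤ) = i + 1 := by simp [hj]
    have hv' : ((v i : ℕ) : ℤ) < (v j : ℕ) := by exact_mod_cast hv
    rw [this]
    linarith
  · rintro x ⟨h1, h2⟩
    rw [Equiv.swap_apply_of_ne_of_ne h1 h2, sub_self]

theorem eq_rev {n : ℕ} (v : Equiv.Perm (Fin n))
    (h : ∀ (i : Fin n) (h : (i : ℕ) + 1 < n), ¬ v i < v ⟨(i : ℕ) + 1, h⟩) : v = Fin.revPerm := by
  cases n with
  | zero => exact Subsingleton.elim _ _
  | succ n =>
    have h1 : StrictMono (fun i => Fin.rev (v i)) := by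
      rw [Fin.strictMono_iff_lt_succ]
      intro i
      rw [Fin.rev_lt_rev]
      have := h i.castSucc (by simp)
      have e : (⟨(i.castSucc : ℕ) + 1, by simp⟩ : Fin (n+1)) = i.succ := by
        apply Fin.ext; simp
      rw [e] at this
      apply lt_of_le_of_ne (not_lt.1 this)
      intro e
      have := v.injective e
      have := congrArg Fin.val this
      simp at this
    have h2 := (StrictMono.range_inj h1 (strictMono_id (α := Fin (n+1)))).1 (by
      rw [Set.range_id]
      exact (Fin.rev_surjective.comp v.surjective).range_eq)
    apply Equiv.ext
    intro x
    have := congrFun h2 x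
    simp only [id] at this
    have h3 := congrArg Fin.rev this
    rw [Fin.rev_rev] at h3
    rw [Fin.revPerm_apply, h3]

theorem mon_ne (T : Finset ℕ) : mon T ≠ 0 := by
  unfold mon; rw [prod_ne_zero_iff]; intro i _; exact X_ne_zero _

theorem last_family {n : ℕ} {S : Equiv.Perm (Fin (n+1)) → MvPolynomial ℕ ℤ}
    (hS : SchubertFamily (n+1) S) : ∃ S', SchubertFamily n S' ∧
      ∀ v, S (ins (Fin.last n) v) = mon (range n) * S' v := by
  obtain ⟨h0, h1⟩ := hS
  have hstep : ∀ (v : Equiv.Perm (Fin n)) (i : Fin n) (h : (i : ℕ) + 1 < n),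
      v i < v ⟨(i : ℕ) + 1, h⟩ →
      (X ((i : ℕ) + 1) - X ((i : ℕ) + 2)) * S (ins (Fin.last n) v) =
      S (ins (Fin.last n) (v * Equiv.swap i ⟨(i : ℕ) + 1, h⟩)) -
        sg i (S (ins (Fin.last n) (v * Equiv.swap i ⟨(i : ℕ) + 1, h⟩))) := by
    intro v i h hv
    have := h1 (ins (Fin.last n) v) i.castSucc (by simp) (by
      have e : (⟨(i.castSucc : ℕ) + 1, by simp⟩ : Fin (n+1)) =
        (Fin.last n).succAbove ⟨(i : ℕ) + 1, h⟩ := by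
          rw [Fin.succAbove_last]; apply Fin.ext; simp
      rw [e, ← Fin.succAbove_last_apply, ins_succAbove, ins_succAbove]
      exact Fin.succ_lt_succ_iff.2 hv)
    rw [ins_last_mul]
    exact this
  have hsym : ∀ i : ℕ, i + 1 < n → sg i (mon (range n)) = mon (range n) := by
    intro i hi
    apply sg_mon_neutral
    simp only [mem_range]; omega
  have hrev : S (ins (Fin.last n) Fin.revPerm) = mon (range n) *
      (∏ i : Fin n, X ((i : ℕ) + 1) ^ (n - 1 - (i : ℕ))) := by
    rw [ins_last_rev, h0, Fin.prod_univ_castSucc]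
    simp only [Fin.val_castSucc, Fin.val_last]
    have : mon (range n) = ∏ i : Fin n, X ((i : ℕ) + 1) := by
      unfold mon; rw [prod_range]
    rw [this, ← prod_mul_distrib]
    simp only [Nat.add_sub_cancel, Nat.sub_self, pow_zero, mul_one]
    apply prod_congr rfl
    intro i _
    rw [← pow_succ']
    congr 1; have := i.2; omega
  have hex : ∀ m, ∀ v : Equiv.Perm (Fin n), pm v = m →
      ∃ q, S (ins (Fin.last n) v) = mon (range n) * q := by
    intro m
    induction m using Nat.strong_induction_on with
    | _ m ih =>
      intro v hm
      by_cases hv : ∀ (i : Fin n) (h : (i : ℕ) + 1 < n), ¬ v i < v ⟨(i : ℕ) + 1, h⟩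
      · rw [eq_rev v hv]; exact ⟨_, hrev⟩
      · push Not at hv
        obtain ⟨i, h, hv⟩ := hv
        obtain ⟨q, hq⟩ := ih _ (hm ▸ pm_lt v i h hv) _ rfl
        obtain ⟨p, hp⟩ := dvd_sub_sg i q
        have := hstep v i h hv
        rw [hq, map_mul, hsym _ h] at this
        refine ⟨p, mul_left_cancel₀ (ab_ne i) ?_⟩
        linear_combination this + (mon (range n)) * hp
  choose S' hS' using fun v => hex _ v rfl
  refine ⟨S', ⟨?_, ?_⟩, hS'⟩
  · apply mul_left_cancel₀ (mon_ne (range n))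
    rw [← hS', hrev]
  · intro v i h hv
    apply mul_left_cancel₀ (mon_ne (range n))
    have := hstep v i h hv
    rw [hS', hS', map_mul, hsym _ h] at this
    unfold sg at this
    linear_combination this

theorem ins_formula {n N : ℕ} {S : Equiv.Perm (Fin (n+1)) → MvPolynomial ℕ ℤ}
    (hS : SchubertFamily (n+1) S) (v : Equiv.Perm (Fin n)) (ks : List ℕ) (hl : ks.length = n)
    (hok : OK ks) (hN : n + 1 ≤ N)
    (hv : S (ins (Fin.last n) v) = mon (range n) * G N ks (dn N n range)) (k : ℕ) :
    ∀ hk : k < n + 1, S (ins ⟨k, hk⟩ v) = mon (range k) * G N ks (dn N n (Bk k)) := by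
  by_cases hkn : k ≤ n
  swap
  · intro hk; omega
  · induction hkn using Nat.decreasingInduction with
    | self =>
      intro hk
      have := G_base (N := N) ks
      rw [hl] at this
      rw [this, ← hv]; rfl
    | of_succ k hkn ih =>
      intro hk
      have h1 := ih (by omega)
      have h2 := hS.2 (ins ⟨k, hk⟩ v) ⟨k, hk⟩ (by simp; omega) (by
        rw [ins_self, Fin.pos_iff_ne_zero]
        intro e
        rw [← ins_self ⟨k, hk⟩ v] at e
        have := congrArg Fin.val ((ins ⟨k, hk⟩ v).injective e)
        simp at this)
      have h3 := ins_swap ⟨k, hkn⟩ v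
      have h4 : ins ⟨k, hk⟩ v * Equiv.swap (⟨k, hk⟩ : Fin (n+1)) ⟨k+1, by omega⟩
        = ins ⟨k+1, by omega⟩ v := h3
      simp only at h2
      rw [h4, h1] at h2
      have h5 := G_step (r := k) ks hok (by omega : ks.length + 1 ≤ N) (by omega)
      rw [hl] at h5
      have h6 : mon (range (k+1)) = mon (range k) * X (k+1) := by
        unfold mon; rw [prod_range_succ]
      have h7 : sg k (mon (range k)) = mon (range k) := sg_mon (by simp) (by simp)
      apply mul_left_cancel₀ (ab_ne k)
      rw [h2]
      change _ - sg k _ = _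
      rw [isDem_iff] at h5
      rw [h6, map_mul, map_mul, sg_a, h7]
      linear_combination (-mon (range k)) * h5

/-! ### columns of diagrams -/

def col (D : Finset (ℕ × ℕ)) (j : ℕ) : Finset ℕ := (D.filter (fun p => p.2 = j)).image Prod.fst

theorem mem_col (D : Finset (ℕ × ℕ)) (i j : ℕ) : i ∈ col D j ↔ (i, j) ∈ D := by
  unfold col
  simp only [mem_image, mem_filter, Prod.exists]
  constructor
  · rintro ⟨a, b, ⟨h1, h2⟩, h3⟩; rw [← h2, ← h3]; exact h1
  · intro h; exact ⟨i, j, ⟨h, rfl⟩, rfl⟩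

theorem mem_rothe (n : ℕ) (w : Equiv.Perm (Fin n)) (i j : ℕ) : (i, j) ∈ rothe n w ↔
    ∃ (a b : Fin n), (a : ℕ) = i ∧ (b : ℕ) = j ∧ b < w a ∧ a < w.symm b := by
  unfold rothe
  simp only [mem_image, mem_filter, mem_univ, true_and, Prod.exists, Prod.mk.injEq, Fin.lt_def]
  constructor
  · rintro ⟨a, b, ⟨h1, h2⟩, h3, h4⟩; exact ⟨a, b, h3, h4, h1, h2⟩
  · rintro ⟨a, b, h3, h4, h1, h2⟩; exact ⟨a, b, ⟨h1, h2⟩, h3, h4⟩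

theorem ins_symm_zero {n : ℕ} (k : Fin (n+1)) (v : Equiv.Perm (Fin n)) : (ins k v).symm 0 = k := by
  rw [Equiv.symm_apply_eq, ins_self]

theorem ins_symm_succ {n : ℕ} (k : Fin (n+1)) (v : Equiv.Perm (Fin n)) (b : Fin n) :
    (ins k v).symm b.succ = k.succAbove (v.symm b) := by
  rw [Equiv.symm_apply_eq, ins_succAbove, Equiv.apply_symm_apply]

theorem rothe_zero {n : ℕ} (k : Fin (n+1)) (v : Equiv.Perm (Fin n)) :
    col (rothe (n+1) (ins k v)) 0 = range k := by
  ext i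
  rw [mem_col, mem_rothe, mem_range]
  constructor
  · rintro ⟨a, b, rfl, hb, h1, h2⟩
    have : b = 0 := Fin.ext hb
    rw [this, ins_symm_zero] at h2
    exact h2
  · intro h
    refine ⟨⟨i, by omega⟩, 0, rfl, rfl, ?_, ?_⟩
    · rw [Fin.pos_iff_ne_zero]
      intro e
      rw [← ins_self k v] at e
      have := congrArg Fin.val ((ins k v).injective e)
      simp at this; omega
    · rw [ins_symm_zero]; exact h

theorem rothe_succ {n : ℕ} (k : Fin (n+1)) (v : Equiv.Perm (Fin n)) (j : ℕ) :
    col (rothe (n+1) (ins k v)) (j+1) = (col (rothe n v) j).image (skip k) := by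
  ext i
  rw [mem_col, mem_rothe, mem_image]
  constructor
  · rintro ⟨a, b, rfl, hb, h1, h2⟩
    obtain ⟨b, rfl⟩ : ∃ c : Fin n, b = c.succ := ⟨b.pred (by rintro rfl; simp at hb), by simp⟩
    rcases Fin.eq_self_or_eq_succAbove k a with h | ⟨z, rfl⟩
    · rw [h, ins_self] at h1; simp at h1
    · rw [ins_succAbove, Fin.succ_lt_succ_iff] at h1
      rw [ins_symm_succ, Fin.succAbove_lt_succAbove_iff] at h2
      refine ⟨z, ?_, (succAbove_val k z).symm⟩
      rw [mem_col, mem_rothe]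
      exact ⟨z, b, rfl, by simpa using hb, h1, h2⟩
  · rintro ⟨z, hz, rfl⟩
    rw [mem_col, mem_rothe] at hz
    obtain ⟨a, b, rfl, rfl, h1, h2⟩ := hz
    refine ⟨k.succAbove a, b.succ, succAbove_val k a, by simp, ?_, ?_⟩
    · rw [ins_succAbove, Fin.succ_lt_succ_iff]; exact h1
    · rw [ins_symm_succ, Fin.succAbove_lt_succAbove_iff]; exact h2

theorem thmA : ∀ (n : ℕ) (w : Equiv.Perm (Fin n)), ∃ ks : List ℕ, ks.length = n ∧ OK ks ∧
    (∀ ι j, topf ks ι j = (col (rothe n w) j).image ι) ∧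
    ∀ S, SchubertFamily n S → ∀ N, n ≤ N → S w = G N ks (dn N n range) := by
  intro n
  induction n with
  | zero =>
    intro w
    refine ⟨[], rfl, trivial, ?_, ?_⟩
    · intro ι j
      have : col (rothe 0 w) j = ∅ := by
        ext i; rw [mem_col, mem_rothe]
        simp
      rw [this]; rfl
    · intro S hS N _
      rw [Subsingleton.elim w Fin.revPerm, hS.1]
      unfold G
      rw [if_pos ⟨range, range_flag (by omega), fle_refl _ _⟩]
      simp
  | succ n ih =>
    intro w
    obtain ⟨k, v, rfl⟩ := ins_surj w
    obtain ⟨ks, h1, h2, h3, h4⟩ := ih v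
    have hk : (k : ℕ) ≤ ks.length := by have := k.2; omega
    refine ⟨k :: ks, by simp [h1], ⟨hk, h2⟩, ?_, ?_⟩
    · intro ι j
      cases j with
      | zero => rw [rothe_zero]; rfl
      | succ j =>
        rw [rothe_succ, image_image, ← h3]; rfl
    · intro S hS N hN
      obtain ⟨S', hS', hl⟩ := last_family hS
      have hv := hl v
      rw [h4 S' hS' N (by omega)] at hv
      have := ins_formula hS v ks h1 h2 hN hv k k.2
      have h5 := G_cons (N := N) ks hk (by omega)
      rw [h1] at h5
      rw [h5, ← this]

end Koh

namespace Koh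
open Finset MvPolynomial

def fcons (T : Finset ℕ) (f : ℕ → Finset ℕ) : ℕ → Finset ℕ
  | 0 => T
  | j+1 => f j

theorem enum {N : ℕ} (ks : List ℕ) : ∀ {I : (ℕ → Finset ℕ) → Prop}, OK ks → Good N ks.length I →
    ∃ F : Finset (ℕ → Finset ℕ), (∀ f, f ∈ F ↔ Pd N ks I f) ∧
      ∑ f ∈ F, ∏ j ∈ range ks.length, mon (f j) = G N ks I := by
  classical
  induction ks with
  | nil =>
    intro I _ _
    by_cases h : ∃ u, I u
    · refine ⟨{fun _ => ∅}, ?_, ?_⟩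
      · intro f; rw [mem_singleton]; unfold Pd
        constructor
        · rintro rfl; exact ⟨h, fun _ => rfl⟩
        · rintro ⟨_, h'⟩; funext j; exact h' j
      · unfold G; rw [if_pos h]; simp
    · refine ⟨∅, ?_, ?_⟩
      · intro f; unfold Pd; simp only [h, false_and]; simp
      · unfold G; rw [if_neg h]; simp
  | cons k ks ih =>
    intro I hok hI
    choose F hF1 hF2 using fun T => ih (I := IT N ks.length k I T) hok.2 (IT_good _ _ _ _ _)
    refine ⟨(range N).powerset.biUnion (fun T => (F T).image (fcons T)), ?_, ?_⟩
    · intro f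
      simp only [mem_biUnion, mem_image]
      constructor
      · rintro ⟨T, _, g, hg, rfl⟩
        exact (hF1 T g).1 hg
      · intro h
        refine ⟨f 0, mem_powerset.2 ((Pd_bd _ hok hI h).1 0), fun j => f (j+1),
          (hF1 _ _).2 h, ?_⟩
        funext j; cases j <;> rfl
    · rw [sum_biUnion, G]
      · apply sum_congr rfl
        intro T _
        rw [sum_image, ← hF2 T, mul_sum]
        · apply sum_congr rfl
          intro f _
          rw [List.length_cons, prod_range_succ']
          rw [mul_comm]; rfl
        · intro f _ g _ h
          funext j; exact congrFun h (j+1)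
      · intro T _ T' _ hne
        rw [Function.onFun, disjoint_left]
        intro f h1 h2
        rw [mem_image] at h1 h2
        obtain ⟨g, _, rfl⟩ := h1
        obtain ⟨g', _, h⟩ := h2
        exact hne (congrFun h 0).symm

theorem col_inj {D D' : Finset (ℕ × ℕ)} (h : col D = col D') : D = D' := by
  ext ⟨i, j⟩; rw [← mem_col, ← mem_col, h]

theorem col_move (D : Finset (ℕ × ℕ)) (s c m : ℕ) :
    col (insert (m, c) (D.erase (s, c))) =
      Function.update (col D) c (insert m ((col D c).erase s)) := by
  funext j
  ext i
  rw [mem_col]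
  by_cases hj : j = c
  · subst hj
    rw [Function.update_self]
    simp only [mem_insert, mem_erase, mem_col, Prod.mk.injEq, and_true, ne_eq]
  · rw [Function.update_of_ne hj, mem_col]
    simp [hj]

theorem KMove_KM {D D' : Finset (ℕ × ℕ)} (h : KMove D D') : KM (col D) (col D') := by
  obtain ⟨s, c, m, h1, h2, h3, h4, h5, rfl⟩ := h
  refine ⟨s, c, m, ?_, ?_, h3, ?_, ?_, col_move D s c m⟩
  · rwa [mem_col]
  · intro c' hc; rw [mem_col]; exact h2 c' hc
  · rwa [mem_col]
  · intro i i1 i2; rw [mem_col]; exact h5 i i1 i2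

theorem KM_KMove {D : Finset (ℕ × ℕ)} {f : ℕ → Finset ℕ} (h : KM (col D) f) :
    ∃ D', KMove D D' ∧ col D' = f := by
  obtain ⟨s, c, m, h1, h2, h3, h4, h5, rfl⟩ := h
  simp only [mem_col] at h1 h2 h4 h5
  exact ⟨_, ⟨s, c, m, h1, h2, h3, h4, h5, rfl⟩, col_move D s c m⟩

theorem reach_col (D0 D : Finset (ℕ × ℕ)) :
    Relation.ReflTransGen KMove D0 D ↔ Relation.ReflTransGen KM (col D0) (col D) := by
  constructor
  · intro h; exact Relation.ReflTransGen.lift col (fun _ _ => KMove_KM) _ _ h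
  · intro h
    have : ∀ f, Relation.ReflTransGen KM (col D0) f →
        ∃ D, Relation.ReflTransGen KMove D0 D ∧ col D = f := by
      intro f h
      induction h with
      | refl => exact ⟨D0, .refl, rfl⟩
      | tail _ h ih =>
        obtain ⟨D1, h1, rfl⟩ := ih
        obtain ⟨D2, h2, h3⟩ := KM_KMove h
        exact ⟨D2, h1.tail h2, h3⟩
    obtain ⟨D', h1, h2⟩ := this _ h
    rwa [← col_inj h2]

def toD (n : ℕ) (f : ℕ → Finset ℕ) : Finset (ℕ × ℕ) :=
  (range n).biUnion (fun j => (f j).image (fun i => (i, j)))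

theorem mem_toD (n : ℕ) (f : ℕ → Finset ℕ) (i j : ℕ) : (i, j) ∈ toD n f ↔ j < n ∧ i ∈ f j := by
  unfold toD
  simp only [mem_biUnion, mem_range, mem_image, Prod.mk.injEq]
  constructor
  · rintro ⟨a, h1, b, h2, rfl, rfl⟩; exact ⟨h1, h2⟩
  · rintro ⟨h1, h2⟩; exact ⟨j, h1, i, h2, rfl, rfl⟩

theorem prod_toD (n : ℕ) (f : ℕ → Finset ℕ) :
    ∏ p ∈ toD n f, (X (p.1 + 1) : MvPolynomial ℕ ℤ) = ∏ j ∈ range n, mon (f j) := by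
  unfold toD
  rw [prod_biUnion]
  · apply prod_congr rfl
    intro j _
    rw [prod_image]
    · rfl
    · intro a _ b _ h; exact (Prod.mk.inj h).1
  · intro a _ b _ hab
    rw [Function.onFun, disjoint_left]
    intro p h1 h2
    rw [mem_image] at h1 h2
    obtain ⟨x, _, rfl⟩ := h1
    obtain ⟨y, _, h⟩ := h2
    exact hab (Prod.mk.inj h).2.symm

theorem col_toD {n : ℕ} {f : ℕ → Finset ℕ} (h : ∀ j, n ≤ j → f j = ∅) : col (toD n f) = f := by
  funext j; ext i
  rw [mem_col, mem_toD]
  constructor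
  · exact fun h => h.2
  · intro hi
    refine ⟨?_, hi⟩
    by_contra hc
    rw [h j (by omega)] at hi; simp at hi

end Koh

/-- **Kohnert's rule for Schubert polynomials**: for every permutation `π`, the Schubert
polynomial is the generating function of the Kohnert diagrams of the Rothe diagram of
`π`: `𝔖_π = ∑_{D ∈ KD(RD(π))} x^{wt(D)}`, where `x^{wt(D)}` has one factor `x_{i}` for
each box of `D` in row `i` (rows numbered from the top starting at `1`). -/
theorem kohnert_rule (n : ℕ)
    (S : Equiv.Perm (Fin n) → MvPolynomial ℕ ℤ) (hS : SchubertFamily n S)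
    (π : Equiv.Perm (Fin n)) :
    S π = ∑ᶠ (D : Finset (ℕ × ℕ)) (_ : Relation.ReflTransGen KMove (rothe n π) D),
            ∏ p ∈ D, X (p.1 + 1) := by
  classical
  obtain ⟨ks, h1, h2, h3, h4⟩ := Koh.thmA n π
  have htop : Koh.topf ks id = Koh.col (rothe n π) := by
    funext j; rw [h3]; simp
  obtain ⟨F, hF1, hF2⟩ := Koh.enum (N := n) ks h2 (Koh.dn_good n ks.length Finset.range)
  have hz : ∀ f ∈ F, Koh.col (Koh.toD n f) = f := fun f hf =>
    Koh.col_toD (h1 ▸ (Koh.Pd_bd ks h2 (Koh.dn_good _ _ _) ((hF1 f).1 hf)).2)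
  have hmem : ∀ D, Relation.ReflTransGen KMove (rothe n π) D ↔ D ∈ F.image (Koh.toD n) := by
    intro D
    rw [Koh.reach_col, ← htop, Koh.reach_iff (N := n) ks h2 (by omega), ← hF1, Finset.mem_image]
    constructor
    · intro h; exact ⟨_, h, Koh.col_inj (hz _ h)⟩
    · rintro ⟨f, hf, rfl⟩; rwa [hz f hf]
  rw [h4 S hS n le_rfl]
  simp only [hmem]
  rw [finsum_mem_finset_eq_sum, Finset.sum_image]
  · rw [h1] at hF2
    rw [← hF2]
    apply Finset.sum_congr rfl
    intro f _
    rw [Koh.prod_toD]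
  · intro f hf g hg h
    rw [← hz f hf, ← hz g hg, h]
end
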